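/- There exist a constant c > 0 and T₀ > 0 such that for every T ≥ T₀ there is a finite set S ⊆ (0, T] of real numbers with cardinality at least c·T such that ζ(1/2 + i t) = 0 for every t ∈ S. In other words, the Riemann zeta function has more than c·T zeros on the critical line with imaginary part in (0, T]. -/

import Mathlib

open MeasureTheory Filter Topology
open scoped ENNReal

/-- The exponential type Fourier integral used throughout. -/
noncomputable def HL.ft (g : ℝ → ℂ) (t : ℝ) : ℂ := ∫ y, g y * Complex.exp (Complex.I * t * y)

namespace HL

lemma norm_char (t y : ℝ) : ‖Complex.exp (Complex.I * t * y)‖ = 1 := by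
  rw [Complex.norm_exp]; simp

lemma integrable_char {g : ℝ → ℂ} (hg : Integrable g) (t : ℝ) :
    Integrable (fun y : ℝ => g y * Complex.exp (Complex.I * t * y)) := by
  refine hg.mul_bdd (c := 1) (by fun_prop) ?_
  filter_upwards with y
  rw [norm_char]

lemma continuous_ft {g : ℝ → ℂ} (hg : Integrable g) : Continuous (ft g) := by
  unfold ft
  refine continuous_of_dominated (bound := fun y => ‖g y‖) ?_ ?_ hg.norm ?_
  · intro t
    exact (integrable_char hg t).aestronglyMeasurable
  · intro t
    filter_upwards with y
    rw [norm_mul, norm_char, mul_one]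
  · filter_upwards with y
    fun_prop

lemma gauss_ft (ε u : ℝ) (hε : 0 < ε) :
    ∫ t : ℝ, Complex.exp (Complex.I * t * u) * (Real.exp (-ε * t ^ 2) : ℂ)
      = ((Real.sqrt (Real.pi / ε) * Real.exp (- u ^ 2 / (4 * ε)) : ℝ) : ℂ) := by
  have h := fourierIntegral_gaussian (b := (ε : ℂ)) (by simpa using hε) (u : ℂ)
  have e1 : ∀ t : ℝ, Complex.exp (Complex.I * t * u) * (Real.exp (-ε * t ^ 2) : ℂ)
     = Complex.exp (Complex.I * u * t) * Complex.exp (-ε * t ^ 2) := by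
    intro t
    push_cast
    congr 2
    ring
  simp_rw [e1]
  rw [h]
  push_cast
  congr 1
  · rw [Real.sqrt_eq_rpow, Complex.ofReal_cpow (by positivity)]
    push_cast
    rfl

lemma gauss_mass (ε : ℝ) (hε : 0 < ε) (x : ℝ) :
    ∫⁻ y : ℝ, ENNReal.ofReal (Real.sqrt (Real.pi / ε) * Real.exp (- (x - y) ^ 2 / (4 * ε)))
      = ENNReal.ofReal (2 * Real.pi) := by
  rw [lintegral_sub_left_eq_self (fun y => ENNReal.ofReal (Real.sqrt (Real.pi / ε) * Real.exp (- y ^ 2 / (4 * ε)))) x]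
  have e : ∀ y : ℝ, - y ^ 2 / (4 * ε) = - (1 / (4 * ε)) * y ^ 2 := by intro y; ring
  simp_rw [e]
  rw [← ofReal_integral_eq_lintegral_ofReal]
  · congr 1
    rw [integral_const_mul, integral_gaussian, ← Real.sqrt_mul (by positivity)]
    rw [show Real.pi / ε * (Real.pi / (1 / (4 * ε))) = (2 * Real.pi) ^ 2 by field_simp; ring]
    exact Real.sqrt_sq (by positivity)
  · exact (integrable_exp_neg_mul_sq (by positivity)).const_mul _
  · filter_upwards with y; positivity

lemma plancherel_reg {g : ℝ → ℂ} (hg : Integrable g) (ε : ℝ) (hε : 0 < ε) :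
    ∫⁻ t, ‖ft g t‖ₑ ^ 2 * ENNReal.ofReal (Real.exp (-ε * t ^ 2))
      ≤ ENNReal.ofReal (2 * Real.pi) * ∫⁻ y, ‖g y‖ₑ ^ 2 := by
  have hgauss : Integrable (fun t : ℝ => Real.exp (-ε * t ^ 2)) := integrable_exp_neg_mul_sq hε
  have hgaussC : Integrable (fun t : ℝ => (Real.exp (-ε * t ^ 2) : ℂ)) := hgauss.ofReal
  have hconj : Integrable (fun y => starRingEnd ℂ (g y)) := by
    refine hg.norm.mono' (Complex.continuous_conj.comp_aestronglyMeasurable hg.aestronglyMeasurable) ?_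
    filter_upwards with y
    rw [RCLike.norm_conj]
  have hG : Integrable (fun p : ℝ × ℝ => g p.1 * starRingEnd ℂ (g p.2)) :=
    hg.mul_prod hconj
  -- step 1
  have s1 : ∀ t : ℝ, ((‖ft g t‖ ^ 2 : ℝ) : ℂ) =
      ∫ p : ℝ × ℝ, (g p.1 * starRingEnd ℂ (g p.2)) * Complex.exp (Complex.I * t * (p.1 - p.2 : ℝ)) := by
    intro t
    have : ((‖ft g t‖ ^ 2 : ℝ) : ℂ) = ft g t * starRingEnd ℂ (ft g t) := by
      rw [Complex.mul_conj, Complex.normSq_eq_norm_sq]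
    rw [this]
    unfold ft
    rw [← integral_conj, ← integral_prod_mul]
    congr 1
    ext p
    simp only [map_mul, ← Complex.exp_conj, Complex.conj_I, Complex.conj_ofReal]
    have : Complex.exp (Complex.I * t * (p.1 - p.2 : ℝ)) = Complex.exp (Complex.I * t * p.1) * Complex.exp (-Complex.I * t * p.2) := by
      rw [← Complex.exp_add]; congr 1; push_cast; ring
    rw [this]; ring
  have hInt3 : Integrable (fun q : ℝ × (ℝ × ℝ) => (Real.exp (-ε * q.1 ^ 2) : ℂ) *
      ((g q.2.1 * starRingEnd ℂ (g q.2.2)) * Complex.exp (Complex.I * q.1 * (q.2.1 - q.2.2 : ℝ)))) := by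
    have := (hgaussC.mul_prod hG)
    have h2 := this.mul_bdd (c := 1) (g := fun q : ℝ × (ℝ × ℝ) => Complex.exp (Complex.I * q.1 * (q.2.1 - q.2.2 : ℝ))) (by
      apply Continuous.aestronglyMeasurable; fun_prop) (by
      filter_upwards with q
      rw [norm_char])
    refine h2.congr ?_
    filter_upwards with q
    ring
  have s2 : ∫ t : ℝ, (Real.exp (-ε * t ^ 2) : ℂ) * ((‖ft g t‖ ^ 2 : ℝ) : ℂ) =
      ∫ p : ℝ × ℝ, (g p.1 * starRingEnd ℂ (g p.2)) *
        ((Real.sqrt (Real.pi / ε) * Real.exp (- (p.1 - p.2) ^ 2 / (4 * ε)) : ℝ) : ℂ) := by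
    simp_rw [s1, ← integral_const_mul]
    rw [integral_integral_swap hInt3]
    congr 1
    ext p
    rw [← gauss_ft ε _ hε, ← integral_const_mul]
    congr 1
    ext t
    ring
  have hnn : ∀ t : ℝ, 0 ≤ Real.exp (-ε * t ^ 2) * ‖ft g t‖ ^ 2 := fun t => by positivity
  have s3 : ∫⁻ t, ‖ft g t‖ₑ ^ 2 * ENNReal.ofReal (Real.exp (-ε * t ^ 2)) =
      ENNReal.ofReal (∫ t : ℝ, Real.exp (-ε * t ^ 2) * ‖ft g t‖ ^ 2) := by
    rw [ofReal_integral_eq_lintegral_ofReal]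
    · congr 1
      ext t
      rw [ENNReal.ofReal_mul (by positivity), mul_comm, ENNReal.ofReal_pow (by positivity), ofReal_norm]
    · refine hgauss.mul_bdd (c := (∫ y, ‖g y‖) ^ 2) ((continuous_ft hg).norm.pow 2).aestronglyMeasurable ?_
      filter_upwards with t
      rw [norm_pow, norm_norm]
      gcongr
      refine (norm_integral_le_integral_norm _).trans (le_of_eq ?_)
      congr 1; ext y
      rw [norm_mul, norm_char, mul_one]
    · filter_upwards with t using hnn t
  rw [s3]
  set k : ℝ → ℝ → ℝ≥0∞ := fun x y => ENNReal.ofReal (Real.sqrt (Real.pi / ε) * Real.exp (- (x - y) ^ 2 / (4 * ε))) with hk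
  have hkm : Measurable (fun p : ℝ × ℝ => k p.1 p.2) := by
    rw [hk]; fun_prop
  have hksymm : ∀ x y, k x y = k y x := by
    intro x y; simp only [hk]; congr 4; ring
  have hgm : AEMeasurable (fun y => ‖g y‖ₑ) := hg.aestronglyMeasurable.enorm
  have s4 : ENNReal.ofReal (∫ t : ℝ, Real.exp (-ε * t ^ 2) * ‖ft g t‖ ^ 2) ≤
      ∫⁻ p : ℝ × ℝ, ‖g p.1‖ₑ * ‖g p.2‖ₑ * k p.1 p.2 := by
    have : ENNReal.ofReal (∫ t : ℝ, Real.exp (-ε * t ^ 2) * ‖ft g t‖ ^ 2) =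
      ‖∫ t : ℝ, (Real.exp (-ε * t ^ 2) : ℂ) * ((‖ft g t‖ ^ 2 : ℝ) : ℂ)‖ₑ := by
      simp_rw [← Complex.ofReal_mul]
      rw [show (∫ t : ℝ, ((Real.exp (-ε * t ^ 2) * ‖ft g t‖ ^ 2 : ℝ) : ℂ)) = ((∫ t : ℝ, Real.exp (-ε * t ^ 2) * ‖ft g t‖ ^ 2 : ℝ) : ℂ) from integral_ofReal, ← ofReal_norm, Complex.norm_real, Real.norm_of_nonneg (integral_nonneg hnn)]
    rw [this, s2]
    refine (enorm_integral_le_lintegral_enorm _).trans (le_of_eq ?_)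
    congr 1; ext p
    rw [enorm_mul, enorm_mul]
    congr 1
    · congr 1
      rw [← ofReal_norm, ← ofReal_norm, RCLike.norm_conj]
    · rw [← ofReal_norm, Complex.norm_real, Real.norm_of_nonneg (by positivity)]
  have young : ∀ a b : ℝ≥0∞, 2 * (a * b) ≤ a ^ 2 + b ^ 2 := by
    intro a b
    by_cases ha : a = ∞
    · simp [ha]
    by_cases hb : b = ∞
    · simp [hb]
    lift a to NNReal using ha
    lift b to NNReal using hb
    norm_cast
    rw [← NNReal.coe_le_coe]
    push_cast
    nlinarith [sq_nonneg ((a:ℝ) - b)]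
  have m1 : AEMeasurable (fun p : ℝ × ℝ => ‖g p.1‖ₑ ^ 2 * k p.1 p.2) (volume.prod volume) :=
    ((hgm.comp_fst).pow_const 2).mul hkm.aemeasurable
  have m2 : AEMeasurable (fun p : ℝ × ℝ => ‖g p.2‖ₑ ^ 2 * k p.1 p.2) (volume.prod volume) :=
    ((hgm.comp_snd).pow_const 2).mul hkm.aemeasurable
  have i1 : ∫⁻ p : ℝ × ℝ, ‖g p.1‖ₑ ^ 2 * k p.1 p.2 = ENNReal.ofReal (2 * Real.pi) * ∫⁻ y, ‖g y‖ₑ ^ 2 := by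
    rw [Measure.volume_eq_prod, lintegral_prod _ m1, ← lintegral_const_mul'' _ (hgm.pow_const 2)]
    congr 1; ext x
    simp only []
    rw [lintegral_const_mul _ (by rw [hk]; fun_prop), mul_comm]
    congr 1
    exact gauss_mass ε hε x
  have i2 : ∫⁻ p : ℝ × ℝ, ‖g p.2‖ₑ ^ 2 * k p.1 p.2 = ENNReal.ofReal (2 * Real.pi) * ∫⁻ y, ‖g y‖ₑ ^ 2 := by
    rw [Measure.volume_eq_prod, lintegral_prod_symm _ m2, ← lintegral_const_mul'' _ (hgm.pow_const 2)]
    congr 1; ext x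
    simp only []
    rw [lintegral_const_mul _ (by rw [hk]; fun_prop), mul_comm]
    congr 1
    simp_rw [fun y => hksymm y x]
    exact gauss_mass ε hε x
  have s5 : 2 * ∫⁻ p : ℝ × ℝ, ‖g p.1‖ₑ * ‖g p.2‖ₑ * k p.1 p.2 ≤
      2 * (ENNReal.ofReal (2 * Real.pi) * ∫⁻ y, ‖g y‖ₑ ^ 2) := by
    rw [← lintegral_const_mul' _ _ (by simp), two_mul (ENNReal.ofReal _ * _)]
    nth_rewrite 1 [← i1]
    rw [← i2, Measure.volume_eq_prod, ← lintegral_add_left' m1]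
    refine lintegral_mono fun p => ?_
    simp only []
    rw [← add_mul, ← mul_assoc]
    exact mul_le_mul_left (young _ _) _
  exact s4.trans ((ENNReal.mul_le_mul_iff_right (by simp) (by simp)).1 s5)

theorem plancherel_le {g : ℝ → ℂ} (hg : Integrable g) :
    ∫⁻ t, ‖ft g t‖ₑ ^ 2 ≤ ENNReal.ofReal (2 * Real.pi) * ∫⁻ y, ‖g y‖ₑ ^ 2 := by
  have hlim : ∀ t : ℝ, Tendsto (fun n : ℕ => ‖ft g t‖ₑ ^ 2 * ENNReal.ofReal (Real.exp (-(1 / ((n : ℝ) + 1)) * t ^ 2))) atTop (𝓝 (‖ft g t‖ₑ ^ 2)) := by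
    intro t
    have h1 : Tendsto (fun n : ℕ => ENNReal.ofReal (Real.exp (-(1 / ((n : ℝ) + 1)) * t ^ 2))) atTop (𝓝 1) := by
      have : Tendsto (fun n : ℕ => Real.exp (-(1 / ((n : ℝ) + 1)) * t ^ 2)) atTop (𝓝 (Real.exp (-0 * t^2))) := by
        refine (Real.continuous_exp.tendsto _).comp ?_
        exact (tendsto_one_div_add_atTop_nhds_zero_nat.neg).mul_const _
      have h2 := (ENNReal.continuous_ofReal.tendsto _).comp this
      simpa [Function.comp_def] using h2
    have := ENNReal.Tendsto.const_mul h1 (a := ‖ft g t‖ₑ ^ 2) (Or.inl (by simp))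
    simpa using this
  calc ∫⁻ t, ‖ft g t‖ₑ ^ 2
      = ∫⁻ t, liminf (fun n : ℕ => ‖ft g t‖ₑ ^ 2 * ENNReal.ofReal (Real.exp (-(1 / ((n : ℝ) + 1)) * t ^ 2))) atTop := by
        congr 1; ext t; exact (hlim t).liminf_eq.symm
    _ ≤ liminf (fun n : ℕ => ∫⁻ t, ‖ft g t‖ₑ ^ 2 * ENNReal.ofReal (Real.exp (-(1 / ((n : ℝ) + 1)) * t ^ 2))) atTop := by
        refine lintegral_liminf_le fun n => ?_
        have := (continuous_ft hg).measurable
        fun_prop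
    _ ≤ _ := by
        refine liminf_le_of_frequently_le' (Frequently.of_forall fun n => ?_)
        exact plancherel_reg hg _ (by positivity)

end HL

open MeasureTheory Filter Topology
open scoped ENNReal
namespace HL

/-- window kernel -/
noncomputable def wk (H y : ℝ) : ℂ := ∫ u in (0:ℝ)..H, Complex.exp (Complex.I * u * y)

/-- window weight -/
noncomputable def W (H y : ℝ) : ℝ := 8 * H ^ 2 / (4 + H ^ 2 * y ^ 2)

lemma W_nonneg (H y : ℝ) : 0 ≤ W H y := by unfold W; positivity

lemma wk_norm_le (H y : ℝ) (hH : 0 ≤ H) : ‖wk H y‖ ≤ H := by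
  unfold wk
  have := intervalIntegral.norm_integral_le_of_norm_le_const (a := (0:ℝ)) (b := H) (C := 1)
    (f := fun u : ℝ => Complex.exp (Complex.I * u * y)) (fun u _ => by rw [norm_char])
  simpa [abs_of_nonneg hH] using this

lemma wk_norm_mul_le (H y : ℝ) : ‖wk H y‖ * |y| ≤ 2 := by
  by_cases hy : y = 0
  · simp [hy]
  have hc : Complex.I * y ≠ 0 := mul_ne_zero Complex.I_ne_zero (by exact_mod_cast hy)
  have : wk H y = (Complex.exp (Complex.I * y * H) - Complex.exp (Complex.I * y * (0:ℝ))) / (Complex.I * y) := by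
    unfold wk
    rw [← integral_exp_mul_complex hc]
    congr 1; ext u; congr 1; ring
  rw [this, norm_div, norm_mul, Complex.norm_I, one_mul, Complex.norm_real, Real.norm_eq_abs,
    div_mul_cancel₀ _ (abs_ne_zero.2 hy)]
  refine (norm_sub_le _ _).trans ?_
  rw [norm_char, norm_char]; norm_num

lemma wk_sq_le (H y : ℝ) (hH : 0 ≤ H) : ‖wk H y‖ ^ 2 ≤ W H y := by
  unfold W
  rw [le_div_iff₀ (by positivity)]
  have h1 := wk_norm_le H y hH
  have h2 := wk_norm_mul_le H y
  have h3 : (‖wk H y‖ * |y|)^2 ≤ 4 := by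
    nlinarith [mul_nonneg (norm_nonneg (wk H y)) (abs_nonneg y)]
  have h4 : ‖wk H y‖^2 ≤ H^2 := by gcongr
  rw [mul_pow, sq_abs] at h3
  nlinarith [mul_le_mul_of_nonneg_left h3 (sq_nonneg H)]

lemma wk_sq_le' (H y : ℝ) : ‖wk H y‖ ^ 2 * y ^ 2 ≤ 4 := by
  have h2 := wk_norm_mul_le H y
  rw [← sq_abs y, ← mul_pow]
  nlinarith [mul_nonneg (norm_nonneg (wk H y)) (abs_nonneg y)]

lemma wk_shift (H t y : ℝ) :
    ∫ u in t..(t + H), Complex.exp (Complex.I * u * y) = Complex.exp (Complex.I * t * y) * wk H y := by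
  have := intervalIntegral.integral_comp_add_right (a := 0) (b := H) (fun u : ℝ => Complex.exp (Complex.I * u * y)) t
  rw [zero_add, add_comm H t] at this
  rw [← this, wk, ← intervalIntegral.integral_const_mul]
  congr 1; ext u
  rw [← Complex.exp_add]; congr 1; push_cast; ring

lemma continuous_wk (H : ℝ) : Continuous (wk H) := by
  unfold wk
  apply intervalIntegral.continuous_parametric_intervalIntegral_of_continuous'
  fun_prop

lemma integrable_mul_wk {g : ℝ → ℂ} (hg : Integrable g) (H : ℝ) (hH : 0 ≤ H) :
    Integrable (fun y => g y * wk H y) :=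
  hg.mul_bdd (c := H) (continuous_wk H).aestronglyMeasurable (by
    filter_upwards with y using wk_norm_le H y hH)

lemma window_ft {g : ℝ → ℂ} (hg : Integrable g) (H t : ℝ) (hH : 0 ≤ H) :
    ∫ u in t..(t + H), ft g u = ft (fun y => g y * wk H y) t := by
  unfold ft
  rw [intervalIntegral.integral_of_le (by linarith)]
  rw [integral_integral_swap]
  · congr 1; ext y
    rw [integral_const_mul, ← intervalIntegral.integral_of_le (by linarith), wk_shift]
    ring
  · have h1 : Integrable (fun _ : ℝ => (1:ℂ)) (volume.restrict (Set.Ioc t (t + H))) := by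
      apply integrable_const
    have h2 := h1.mul_prod hg
    have h3 := h2.mul_bdd (c := 1) (g := fun q : ℝ × ℝ => Complex.exp (Complex.I * q.1 * q.2)) (by
      apply Continuous.aestronglyMeasurable; fun_prop) (by
      filter_upwards with q
      rw [norm_char])
    refine h3.congr ?_
    filter_upwards with q
    simp [Function.uncurry]

theorem window_plancherel {g : ℝ → ℂ} (hg : Integrable g) (H : ℝ) (hH : 0 ≤ H) :
    ∫⁻ t, ‖∫ u in t..(t + H), ft g u‖ₑ ^ 2 ≤
      ENNReal.ofReal (2 * Real.pi) * ∫⁻ y, ENNReal.ofReal (‖g y‖ ^ 2 * ‖wk H y‖ ^ 2) := by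
  simp_rw [window_ft hg H _ hH]
  refine (plancherel_le (integrable_mul_wk hg H hH)).trans (le_of_eq ?_)
  congr 2; ext y
  rw [← mul_pow, ← norm_mul, ENNReal.ofReal_pow (norm_nonneg _), ofReal_norm]

end HL

open MeasureTheory Filter Topology
open scoped ENNReal
namespace HL

lemma prod_ratio_lower (v : ℝ) (hv : 1 ≤ v) (n : ℕ) :
    (n : ℝ) / (3 * v) ≤ ∏ j ∈ Finset.range n, ((((j : ℝ) + 3 / 4) ^ 2 + v ^ 2) / (((j : ℝ) + 1 / 4) ^ 2 + v ^ 2)) := by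
  have hone : ∀ n : ℕ, 1 ≤ ∏ j ∈ Finset.range n, ((((j : ℝ) + 3 / 4) ^ 2 + v ^ 2) / (((j : ℝ) + 1 / 4) ^ 2 + v ^ 2)) := by
    intro n
    induction n with
    | zero => simp
    | succ n ih =>
      rw [Finset.prod_range_succ]
      refine one_le_mul_of_one_le_of_one_le ih ?_
      rw [one_le_div (by positivity)]
      have : (0:ℝ) ≤ n := by positivity
      nlinarith
  set j0 := ⌈v⌉₊ with hj0
  have hj1 : v ≤ j0 := Nat.le_ceil v
  have hj2 : (j0 : ℝ) < v + 1 := Nat.ceil_lt_add_one (by linarith)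
  have key : ∀ n : ℕ, j0 ≤ n → ((n : ℝ) ^ 2 + v ^ 2) / n / (3 * v) ≤ ∏ j ∈ Finset.range n, ((((j : ℝ) + 3 / 4) ^ 2 + v ^ 2) / (((j : ℝ) + 1 / 4) ^ 2 + v ^ 2)) := by
    intro n hn
    induction n, hn using Nat.le_induction with
    | base =>
      refine le_trans ?_ (hone j0)
      have : 0 < (j0 : ℝ) := by linarith
      rw [div_div, div_le_one (by positivity)]
      nlinarith [mul_nonneg (sub_nonneg.2 hj1) (sub_nonneg.2 hj2.le)]
    | succ n hn ih =>
      rw [Finset.prod_range_succ]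
      have hn0 : (1:ℝ) ≤ n := by
        have : (j0 : ℝ) ≤ n := by exact_mod_cast hn
        linarith
      refine le_trans ?_ (mul_le_mul_of_nonneg_right ih (by positivity))
      push_cast
      rw [div_div, div_div, div_mul_div_comm, div_le_div_iff₀ (by positivity) (by positivity)]
      have main : (((n:ℝ) + 1) ^ 2 + v ^ 2) * (n * (((n:ℝ) + 1 / 4) ^ 2 + v ^ 2)) ≤ ((n:ℝ)^2 + v^2) * (((n:ℝ) + 3 / 4) ^ 2 + v ^ 2) * (n + 1) := by
        have hv2 : 1 ≤ v ^ 2 := by nlinarith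
        have e : ((n:ℝ)^2 + v^2) * (((n:ℝ) + 3 / 4) ^ 2 + v ^ 2) * (n + 1) - (((n:ℝ) + 1) ^ 2 + v ^ 2) * (n * (((n:ℝ) + 1 / 4) ^ 2 + v ^ 2))
          = (v^2 - 1/16) * n^2 + (v^2 - 1/16) * n + v^2 * (v^2 + 9/16) := by ring
        have : 0 ≤ (v^2 - 1/16) * n^2 + (v^2 - 1/16) * n + v^2 * (v^2 + 9/16) := by
          have : 0 ≤ v^2 - 1/16 := by linarith
          positivity
        linarith
      have := mul_le_mul_of_nonneg_left main (by positivity : 0 ≤ 3 * v)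
      nlinarith [this]
  by_cases h : j0 ≤ n
  · refine le_trans ?_ (key n h)
    have hn0 : (0:ℝ) < n := by
        have : (j0 : ℝ) ≤ n := by exact_mod_cast h
        linarith
    gcongr
    rw [le_div_iff₀ hn0]; nlinarith
  · refine le_trans ?_ (hone n)
    rw [div_le_one (by positivity)]
    have : (n : ℝ) ≤ j0 := by exact_mod_cast (not_le.1 h).le
    linarith

lemma GammaSeq_normSq (σ v : ℝ) (n : ℕ) (hn : n ≠ 0) :
    ‖Complex.GammaSeq (σ + Complex.I * v) n‖ ^ 2 =
      (n : ℝ) ^ (2 * σ) * (n.factorial : ℝ) ^ 2 / ∏ j ∈ Finset.range (n + 1), (((j : ℝ) + σ) ^ 2 + v ^ 2) := by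
  unfold Complex.GammaSeq
  rw [norm_div, norm_mul, norm_prod, div_pow, mul_pow, ← Finset.prod_pow]
  have h1 : ‖(n : ℂ) ^ ((σ : ℂ) + Complex.I * v)‖ ^ 2 = (n : ℝ) ^ (2 * σ) := by
    rw [← Complex.ofReal_natCast, Complex.norm_cpow_eq_rpow_re_of_pos (by positivity)]
    simp only [Complex.add_re, Complex.ofReal_re, Complex.mul_re, Complex.I_re, zero_mul, Complex.I_im,
      Complex.ofReal_im, mul_zero, sub_zero, add_zero]
    rw [← Real.rpow_natCast, ← Real.rpow_mul (by positivity)]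
    congr 1; push_cast; ring
  rw [h1]
  congr 1
  · simp
  · refine Finset.prod_congr rfl fun j _ => ?_
    rw [← Complex.normSq_eq_norm_sq, Complex.normSq_apply]
    simp; ring

lemma gamma_ratio (v : ℝ) (hv : 1 ≤ v) :
    ‖Complex.Gamma ((3 / 4 : ℝ) + Complex.I * v)‖ ^ 2 ≤ 3 * v * ‖Complex.Gamma ((1 / 4 : ℝ) + Complex.I * v)‖ ^ 2 := by
  have t1 := ((Complex.GammaSeq_tendsto_Gamma ((3 / 4 : ℝ) + Complex.I * v)).norm.pow 2)
  have t2 := ((Complex.GammaSeq_tendsto_Gamma ((1 / 4 : ℝ) + Complex.I * v)).norm.pow 2).const_mul (3 * v)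
  refine le_of_tendsto_of_tendsto t1 t2 ?_
  filter_upwards [eventually_ne_atTop 0] with n hn
  rw [GammaSeq_normSq _ _ _ hn, GammaSeq_normSq _ _ _ hn]
  have hp := prod_ratio_lower v hv (n + 1)
  rw [Finset.prod_div_distrib] at hp
  set A := ∏ j ∈ Finset.range (n + 1), (((j : ℝ) + 1 / 4) ^ 2 + v ^ 2) with hA
  set B := ∏ j ∈ Finset.range (n + 1), (((j : ℝ) + 3 / 4) ^ 2 + v ^ 2) with hB
  have hApos : 0 < A := Finset.prod_pos fun j _ => by positivity
  have hBpos : 0 < B := Finset.prod_pos fun j _ => by positivity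
  have hn0 : (0 : ℝ) < n := by positivity
  rw [show (2 : ℝ) * (3 / 4) = 2 * (1 / 4) + 1 by norm_num, Real.rpow_add hn0, Real.rpow_one]
  rw [div_le_div_iff₀ (by positivity) hApos] at hp
  rw [← mul_div_assoc (3 * v), div_le_div_iff₀ hBpos hApos]
  have : (n : ℝ) * A ≤ 3 * v * B := by push_cast at hp; nlinarith
  have h := mul_le_mul_of_nonneg_left this (by positivity : 0 ≤ (n : ℝ) ^ ((2:ℝ) * (1 / 4)) * (n.factorial : ℝ) ^ 2)
  nlinarith [h]

lemma gamma_prod (v : ℝ) :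
    Real.pi * Real.exp (- (Real.pi * |v|)) ≤ ‖Complex.Gamma ((1 / 4 : ℝ) + Complex.I * v)‖ * ‖Complex.Gamma ((3 / 4 : ℝ) + Complex.I * v)‖ := by
  have hr := Complex.Gamma_mul_Gamma_one_sub ((1 / 4 : ℝ) + Complex.I * v)
  have hc : Complex.Gamma (1 - ((1 / 4 : ℝ) + Complex.I * v)) = starRingEnd ℂ (Complex.Gamma ((3 / 4 : ℝ) + Complex.I * v)) := by
    rw [← Complex.Gamma_conj]; congr 1
    rw [map_add, map_mul, Complex.conj_I, Complex.conj_ofReal, Complex.conj_ofReal]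
    push_cast; ring
  rw [hc] at hr
  have h2 := congrArg norm hr
  rw [norm_mul, RCLike.norm_conj, norm_div, Complex.norm_real, Real.norm_of_nonneg Real.pi_pos.le] at h2
  rw [h2]
  set w := (Real.pi : ℂ) * ((1 / 4 : ℝ) + Complex.I * v) with hw
  have hle : ‖Complex.sin w‖ ≤ Real.exp (Real.pi * |v|) := by
    unfold Complex.sin
    rw [norm_div, norm_mul, Complex.norm_I, mul_one]
    have h1 : ‖Complex.exp (-w * Complex.I)‖ ≤ Real.exp (Real.pi * |v|) := by
      rw [Complex.norm_exp]
      apply Real.exp_le_exp.2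
      simp [hw]
      gcongr
      exact le_abs_self v
    have h2 : ‖Complex.exp (w * Complex.I)‖ ≤ Real.exp (Real.pi * |v|) := by
      rw [Complex.norm_exp]
      apply Real.exp_le_exp.2
      simp [hw]
      rw [← mul_neg]
      gcongr
      exact neg_le_abs v
    have h3 := norm_sub_le (Complex.exp (-w * Complex.I)) (Complex.exp (w * Complex.I))
    simp only [Complex.norm_ofNat]
    linarith
  have hs : Complex.sin w ≠ 0 := by
    rw [Ne, Complex.sin_eq_zero_iff]
    rintro ⟨k, hk⟩
    have := congrArg Complex.re hk
    simp [hw] at this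
    have h4 : (1 / 4 : ℝ) = k := by
      have := mul_left_cancel₀ Real.pi_ne_zero (this.trans (mul_comm _ _))
      rw [← this]; norm_num
    have h5 : (1 : ℝ) = 4 * k := by linarith
    have h6 : (1 : ℤ) = 4 * k := by exact_mod_cast h5
    omega
  rw [Real.exp_neg, ← div_eq_mul_inv]
  gcongr

/-- The Stirling type lower bound on the line of real part one quarter. -/
theorem gamma_lower (v : ℝ) (hv : 1 ≤ v) :
    v ^ (-(1 / 4) : ℝ) * Real.exp (-(Real.pi * v / 2)) ≤ ‖Complex.Gamma ((1 / 4 : ℝ) + Complex.I * v)‖ := by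
  have h1 := gamma_ratio v hv
  have h2 := gamma_prod v
  rw [abs_of_nonneg (by linarith)] at h2
  set X := ‖Complex.Gamma ((1 / 4 : ℝ) + Complex.I * v)‖
  set Y := ‖Complex.Gamma ((3 / 4 : ℝ) + Complex.I * v)‖
  have hX : 0 ≤ X := norm_nonneg _
  have hY : 0 ≤ Y := norm_nonneg _
  refine le_of_pow_le_pow_left₀ (n := 4) (by norm_num) hX ?_
  have hv0 : 0 < v := by linarith
  have e1 : (v ^ (-(1 / 4) : ℝ) * Real.exp (-(Real.pi * v / 2))) ^ 4 = v⁻¹ * Real.exp (-(Real.pi * v)) ^ 2 := by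
    rw [mul_pow, ← Real.rpow_natCast, ← Real.rpow_mul hv0.le, ← Real.exp_nat_mul, ← Real.exp_nat_mul]
    norm_num
    rw [Real.rpow_neg_one]
    field_simp
    norm_num
    ring
  rw [e1]
  have h3 : (Real.pi * Real.exp (-(Real.pi * v))) ^ 2 ≤ (X * Y) ^ 2 := by gcongr
  have h4 : (X * Y) ^ 2 ≤ 3 * v * X ^ 4 := by
    nlinarith [mul_le_mul_of_nonneg_left h1 (sq_nonneg X)]
  have h5 : 3 * Real.exp (-(Real.pi * v)) ^ 2 ≤ 3 * v * X ^ 4 := by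
    refine le_trans ?_ (h3.trans h4)
    rw [mul_pow]
    gcongr
    nlinarith [Real.pi_gt_three]
  rw [inv_mul_le_iff₀ hv0]
  linarith

end HL

open MeasureTheory Filter Topology Asymptotics
open scoped ENNReal
namespace HL

/-- complex valued fractional part -/
noncomputable def frc (u : ℝ) : ℂ := ((Int.fract u : ℝ) : ℂ)

lemma frc_norm_le (u : ℝ) : ‖frc u‖ ≤ 1 := by
  unfold frc
  rw [Complex.norm_real, Real.norm_of_nonneg (Int.fract_nonneg _)]
  exact (Int.fract_lt_one _).le

lemma measurable_frc : Measurable frc := by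
  unfold frc; fun_prop

lemma locInt_of_bdd {f : ℝ → ℂ} (hf : Measurable f) (hb : ∀ u, ‖f u‖ ≤ 1) (s : Set ℝ) :
    LocallyIntegrableOn f s := by
  apply LocallyIntegrable.locallyIntegrableOn
  refine (locallyIntegrable_const (1:ℝ)).mono hf.aestronglyMeasurable ?_
  filter_upwards with u
  simpa using hb u

lemma isBigO_top_of_bdd {f : ℝ → ℂ} (hb : ∀ u, ‖f u‖ ≤ 1) : f =O[atTop] (fun x : ℝ => x ^ (-(0:ℝ))) := by
  refine IsBigO.of_bound 1 ?_
  filter_upwards with u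
  simpa using hb u

lemma frc_small {u : ℝ} (h0 : 0 ≤ u) (h1 : u < 1) : frc u = u := by
  unfold frc; rw [Int.fract_eq_self.2 ⟨h0, h1⟩]

lemma frc_mellinConvergent {s : ℂ} (h0 : 0 < s.re) (h1 : s.re < 1) : MellinConvergent frc (-s) := by
  refine mellinConvergent_of_isBigO_rpow (a := 0) (b := -1) (locInt_of_bdd measurable_frc frc_norm_le _)
    (isBigO_top_of_bdd frc_norm_le) (by simpa using h0) ?_ (by simp; linarith)
  refine IsBigO.of_bound 1 ?_
  have : Set.Ioo (0:ℝ) 1 ∈ 𝓝[>] (0:ℝ) := Ioo_mem_nhdsGT one_pos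
  filter_upwards [this] with u hu
  rw [frc_small hu.1.le hu.2]
  simp

/-- fractional part cut off at one -/
noncomputable def frc1 : ℝ → ℂ := Set.indicator (Set.Ioi 1) frc

lemma frc1_norm_le (u : ℝ) : ‖frc1 u‖ ≤ 1 := by
  unfold frc1
  exact (norm_indicator_le_norm_self _ _).trans (frc_norm_le u)

lemma measurable_frc1 : Measurable frc1 := measurable_frc.indicator measurableSet_Ioi

lemma frc1_bot (b : ℝ) : frc1 =O[𝓝[>] 0] (fun x : ℝ => x ^ (-b)) := by
  refine IsBigO.of_bound 1 ?_
  have : Set.Ioo (0:ℝ) 1 ∈ 𝓝[>] (0:ℝ) := Ioo_mem_nhdsGT one_pos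
  filter_upwards [this] with u hu
  have : frc1 u = 0 := by
    unfold frc1; apply Set.indicator_of_notMem; simp; exact hu.2.le
  rw [this]; simp

lemma frc1_conv {s : ℂ} (h0 : 0 < s.re) : MellinConvergent frc1 (-s) :=
  mellinConvergent_of_isBigO_rpow (a := 0) (b := -s.re - 1) (locInt_of_bdd measurable_frc1 frc1_norm_le _)
    (isBigO_top_of_bdd frc1_norm_le) (by simpa using h0) (frc1_bot _) (by simp)

lemma frc1_diff {s : ℂ} (h0 : 0 < s.re) : DifferentiableAt ℂ (fun s => mellin frc1 (-s)) s := by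
  have : DifferentiableAt ℂ (mellin frc1) (-s) :=
    mellin_differentiableAt_of_isBigO_rpow (a := 0) (b := -s.re - 1) (locInt_of_bdd measurable_frc1 frc1_norm_le _)
      (isBigO_top_of_bdd frc1_norm_le) (by simpa using h0) (frc1_bot _) (by simp)
  exact this.comp s (differentiableAt_id.neg)

lemma mellin_frc1 (s : ℂ) : mellin frc1 (-s) = ∫ t in Set.Ioi (1:ℝ), frc t * (t:ℂ) ^ (-(s + 1)) := by
  unfold mellin
  have : ∀ t : ℝ, (t:ℂ) ^ (-s - 1) • frc1 t = Set.indicator (Set.Ioi 1) (fun t : ℝ => frc t * (t:ℂ) ^ (-(s + 1))) t := by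
    intro t
    unfold frc1
    by_cases h : t ∈ Set.Ioi (1:ℝ)
    · rw [Set.indicator_of_mem h, Set.indicator_of_mem h, smul_eq_mul, mul_comm]
      congr 2; ring
    · rw [Set.indicator_of_notMem h, Set.indicator_of_notMem h, smul_zero]
  simp_rw [this]
  rw [setIntegral_indicator measurableSet_Ioi]
  congr 2
  ext x
  simp

lemma zeta_rep1 {s : ℂ} (hs : 1 < s.re) : riemannZeta s = s / (s - 1) - s * mellin frc1 (-s) := by
  have h := LSeries_eq_mul_integral_of_nonneg (fun _ => (1:ℝ)) (r := 1) zero_le_one hs (by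
    simp only [Finset.sum_const, Nat.card_Icc, add_tsub_cancel_right, nsmul_eq_mul, mul_one, Real.rpow_one]
    exact isBigO_refl _ _) (fun _ => zero_le_one)
  have h1 : LSeries (fun n => (((1:ℝ)) : ℂ)) s = riemannZeta s := by
    rw [← LSeries_one_eq_riemannZeta hs]
    rfl
  rw [h1] at h
  rw [h, mellin_frc1]
  have hne : s - 1 ≠ 0 := by
    intro h
    have : s = 1 := by linear_combination h
    rw [this] at hs; simp at hs
  have e : ∀ t ∈ Set.Ioi (1:ℝ), (∑ k ∈ Finset.Icc 1 ⌊t⌋₊, (((1:ℝ)):ℂ)) * (t:ℂ) ^ (-(s + 1)) =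
      (t:ℂ) ^ (-s) - frc t * (t:ℂ) ^ (-(s + 1)) := by
    intro t ht
    have ht0 : (0:ℝ) < t := lt_trans one_pos ht
    have : (t:ℂ) ^ (-s) = t * (t:ℂ) ^ (-(s + 1)) := by
      rw [show -s = 1 + -(s + 1) by ring, Complex.cpow_add _ _ (by exact_mod_cast ht0.ne'), Complex.cpow_one]
    rw [this, ← sub_mul]
    congr 1
    unfold frc
    simp only [Complex.ofReal_one, Finset.sum_const, Nat.card_Icc, add_tsub_cancel_right, nsmul_eq_mul, mul_one]
    rw [← Complex.ofReal_sub, Int.self_sub_fract, ← natCast_floor_eq_intCast_floor ht0.le]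
    simp
  rw [setIntegral_congr_fun measurableSet_Ioi e, integral_sub, integral_Ioi_cpow_of_lt (by simpa using hs) one_pos]
  · simp
    rw [show -s + 1 = -(s - 1) by ring]
    field_simp
  · exact integrableOn_Ioi_cpow_of_lt (by simpa using hs) one_pos
  · have := (integrableOn_Ioi_cpow_of_lt (a := -(s+1)) (c := 1) (by simp; linarith) one_pos)
    exact this.bdd_mul (c := 1) measurable_frc.aestronglyMeasurable (by filter_upwards with t using frc_norm_le t)

lemma zeta_rep2 {s : ℂ} (hs : 0 < s.re) (h1 : s ≠ 1) : riemannZeta s = s / (s - 1) - s * mellin frc1 (-s) := by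
  have hU : IsOpen {s : ℂ | 0 < s.re} := isOpen_lt continuous_const Complex.continuous_re
  have hE : Set.EqOn riemannZeta₁ (fun s => s - (s - 1) * s * mellin frc1 (-s)) {s : ℂ | 0 < s.re} := by
    refine AnalyticOnNhd.eqOn_of_preconnected_of_eventuallyEq (𝕜 := ℂ) (z₀ := 2) ?_ ?_ ?_ ?_ ?_
    · exact (differentiable_riemannZeta₁.differentiableOn).analyticOnNhd hU
    · refine DifferentiableOn.analyticOnNhd (fun s hs => ?_) hU
      have := frc1_diff hs
      apply DifferentiableAt.differentiableWithinAt
      fun_prop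
    · exact (convex_halfSpace_re_gt 0).isPreconnected
    · simp
    · have : {s : ℂ | 1 < s.re} ∈ 𝓝 (2:ℂ) := (isOpen_lt continuous_const Complex.continuous_re).mem_nhds (by simp)
      filter_upwards [this] with z hz
      have hne : z ≠ 1 := by rintro rfl; simp at hz
      have hne' : z - 1 ≠ 0 := sub_ne_zero.2 hne
      have a := riemannZeta_eq_inv_sub_mul hne
      have b := zeta_rep1 hz
      have : riemannZeta₁ z = (z - 1) * riemannZeta z := by rw [a]; field_simp
      rw [this, b]; field_simp
  have hne' : s - 1 ≠ 0 := sub_ne_zero.2 h1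
  rw [riemannZeta_eq_inv_sub_mul h1, hE hs]
  field_simp

theorem zeta_rep {s : ℂ} (h0 : 0 < s.re) (h1 : s.re < 1) : riemannZeta s = - s * mellin frc (-s) := by
  have hne : s ≠ 1 := by rintro rfl; simp at h1
  have hne' : s - 1 ≠ 0 := sub_ne_zero.2 hne
  have hne'' : 1 - s ≠ 0 := sub_ne_zero.2 hne.symm
  rw [zeta_rep2 h0 hne]
  have hI := frc_mellinConvergent h0 h1
  have : mellin frc (-s) = 1 / (1 - s) + mellin frc1 (-s) := by
    rw [mellin_frc1]
    unfold mellin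
    rw [← Set.Ioc_union_Ioi_eq_Ioi (zero_le_one' ℝ), setIntegral_union]
    · congr 1
      · have e : ∫ t in Set.Ioc (0:ℝ) 1, (t:ℂ) ^ (-s - 1) • frc t = ∫ t in Set.Ioc (0:ℝ) 1, (t:ℂ) ^ (-s) := by
          rw [integral_Ioc_eq_integral_Ioo, integral_Ioc_eq_integral_Ioo]
          refine setIntegral_congr_fun measurableSet_Ioo fun t ht => ?_
          rw [frc_small ht.1.le ht.2, smul_eq_mul]
          rw [show -s = (-s - 1) + 1 by ring, Complex.cpow_add _ _ (by exact_mod_cast ht.1.ne'), Complex.cpow_one]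
          congr 2; ring
        rw [e, ← intervalIntegral.integral_of_le zero_le_one, integral_cpow (Or.inl (by simp; linarith))]
        rw [show -s + 1 = 1 - s by ring]
        simp [Complex.zero_cpow hne'']
      · refine setIntegral_congr_fun measurableSet_Ioi fun t ht => ?_
        simp only [smul_eq_mul]
        rw [mul_comm]; congr 2; ring
    · exact Set.Ioc_disjoint_Ioi le_rfl
    · exact measurableSet_Ioi
    · exact hI.mono_set Set.Ioc_subset_Ioi_self
    · exact hI.mono_set (Set.Ioi_subset_Ioi zero_le_one)
  rw [this]
  field_simp
  ring

end HL

open MeasureTheory Filter Topology Asymptotics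
open scoped ENNReal
namespace HL
open Complex (I)

lemma mellin_aux (f : ℝ → ℂ) (s : ℂ) (y : ℝ) :
    |Real.exp y| • (((Real.exp y : ℝ) : ℂ) ^ (s - 1) • f (Real.exp y)) = f (Real.exp y) * Complex.exp (s * y) := by
  rw [abs_of_pos (Real.exp_pos y), Complex.real_smul, smul_eq_mul, ← mul_assoc]
  rw [Complex.cpow_def_of_ne_zero (by exact_mod_cast (Real.exp_pos y).ne'), ← Complex.ofReal_log (Real.exp_pos y).le,
    Real.log_exp, Complex.ofReal_exp, ← Complex.exp_add, mul_comm]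
  congr 2; ring

lemma mellin_log (f : ℝ → ℂ) (s : ℂ) : mellin f s = ∫ y : ℝ, f (Real.exp y) * Complex.exp (s * y) := by
  unfold mellin
  have h := integral_image_eq_integral_abs_deriv_smul (s := Set.univ) (f := Real.exp) (f' := Real.exp)
    MeasurableSet.univ (fun x _ => (Real.hasDerivAt_exp x).hasDerivWithinAt) Real.exp_injective.injOn
    (fun t : ℝ => (t:ℂ) ^ (s - 1) • f t)
  rw [Set.image_univ, Real.range_exp] at h
  rw [h, setIntegral_univ]
  exact integral_congr_ae (Eventually.of_forall fun y => mellin_aux f s y)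

lemma mellinConvergent_log {f : ℝ → ℂ} {s : ℂ} :
    MellinConvergent f s ↔ Integrable (fun y : ℝ => f (Real.exp y) * Complex.exp (s * y)) := by
  unfold MellinConvergent
  have h := integrableOn_image_iff_integrableOn_abs_deriv_smul (s := Set.univ) (f := Real.exp) (f' := Real.exp)
    MeasurableSet.univ (fun x _ => (Real.hasDerivAt_exp x).hasDerivWithinAt) Real.exp_injective.injOn
    (fun t : ℝ => (t:ℂ) ^ (s - 1) • f t)
  rw [Set.image_univ, Real.range_exp] at h
  rw [h, integrableOn_univ]
  exact integrable_congr (Eventually.of_forall fun y => mellin_aux f s y)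

/-- weighted fractional part in the logarithmic variable -/
noncomputable def Af (w : ℝ) : ℂ := frc (Real.exp w) * (Real.exp (-w / 2) : ℝ)

lemma integrable_Af : Integrable Af := by
  have := (mellinConvergent_log (f := frc) (s := -(1/2 : ℂ))).1 (frc_mellinConvergent (by norm_num) (by norm_num))
  refine this.congr (Eventually.of_forall fun y => ?_)
  unfold Af
  push_cast
  congr 2; ring

lemma ft_Af (t : ℝ) : riemannZeta (1 / 2 + I * t) = - (1 / 2 + I * t) * ft Af (-t) := by
  rw [zeta_rep (by simp) (by simp; norm_num), mellin_log]
  congr 1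
  unfold ft Af
  refine integral_congr_ae (Eventually.of_forall fun y => ?_)
  dsimp only
  push_cast
  rw [mul_assoc, ← Complex.exp_add]
  congr 2; ring

end HL

open MeasureTheory Filter Topology Asymptotics
open scoped ENNReal
namespace HL
open Complex (I)

lemma integrable_ge {β c : ℝ} (hβ : 0 < β) (hc : 0 < c) :
    Integrable (fun y : ℝ => Real.exp (β * y - c * Real.exp y)) := by
  have h1 : MellinConvergent (fun x : ℝ => ((Real.exp (-x) : ℝ) : ℂ)) (β : ℂ) := by
    have := Complex.GammaIntegral_convergent (s := (β:ℂ)) (by simpa using hβ)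
    unfold MellinConvergent
    refine this.congr_fun (fun x hx => ?_) measurableSet_Ioi
    simp [mul_comm]
  have h2 := mellinConvergent_log.1 ((MellinConvergent.comp_mul_left hc).2 h1)
  refine h2.norm.congr (Eventually.of_forall fun y => ?_)
  dsimp only
  rw [norm_mul, Complex.norm_real, Complex.norm_exp, Real.norm_of_nonneg (Real.exp_pos _).le, ← Real.exp_add]
  congr 1
  simp
  ring

/-- rotated Gamma integrand in the logarithmic variable -/
noncomputable def Kg (a : ℂ) (θ y : ℝ) : ℂ := Complex.exp (a * (y + I * θ) - Complex.exp (y + I * θ))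

lemma Kg_norm (a : ℂ) (θ y : ℝ) : ‖Kg a θ y‖ = Real.exp (a.re * y - a.im * θ - Real.exp y * Real.cos θ) := by
  unfold Kg
  rw [Complex.norm_exp]
  congr 1
  simp [Complex.exp_re]

lemma Kg_dθ (a : ℂ) (θ y : ℝ) : HasDerivAt (fun θ : ℝ => Kg a θ y) (I * (a - Complex.exp (y + I * θ)) * Kg a θ y) θ := by
  have h0 : HasDerivAt (fun θ : ℝ => ((y:ℂ) + I * θ)) I θ := by
    simpa using ((Complex.ofRealCLM.hasDerivAt (x := θ)).const_mul I).const_add (y:ℂ)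
  have h1 := ((h0.const_mul a).sub h0.cexp).cexp
  refine HasDerivAt.congr_deriv h1 ?_
  simp only [Pi.sub_apply, Kg]
  ring

lemma Kg_dy (a : ℂ) (θ y : ℝ) : HasDerivAt (fun y : ℝ => Kg a θ y) ((a - Complex.exp (y + I * θ)) * Kg a θ y) y := by
  have h0 : HasDerivAt (fun y : ℝ => ((y:ℂ) + I * θ)) 1 y := by
    simpa using ((Complex.ofRealCLM.hasDerivAt (x := y))).add_const (I * θ : ℂ)
  have h1 := ((h0.const_mul a).sub h0.cexp).cexp
  refine HasDerivAt.congr_deriv h1 ?_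
  simp only [Pi.sub_apply, Kg]
  ring

lemma continuous_Kg (a : ℂ) (θ : ℝ) : Continuous (Kg a θ) := by
  unfold Kg; fun_prop

/-- dominating function -/
noncomputable def Kb (a : ℂ) (c y : ℝ) : ℝ :=
  Real.exp (|a.im| * 2) * (‖a‖ * Real.exp (a.re * y - c * Real.exp y) + Real.exp ((a.re + 1) * y - c * Real.exp y))

lemma integrable_Kb {a : ℂ} (ha : 0 < a.re) {c : ℝ} (hc : 0 < c) : Integrable (Kb a c) :=
  (((integrable_ge ha hc).const_mul _).add (integrable_ge (by linarith) hc)).const_mul _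

lemma Kg_norm_le (a : ℂ) {c θ : ℝ} (h1 : |θ| ≤ 2) (h2 : c ≤ Real.cos θ) (y : ℝ) :
    ‖Kg a θ y‖ ≤ Real.exp (|a.im| * 2) * Real.exp (a.re * y - c * Real.exp y) := by
  rw [Kg_norm, ← Real.exp_add]
  apply Real.exp_le_exp.2
  have : -(a.im * θ) ≤ |a.im| * 2 := by
    calc -(a.im * θ) ≤ |a.im * θ| := neg_le_abs _
      _ = |a.im| * |θ| := abs_mul _ _
      _ ≤ _ := by gcongr
  have h3 : c * Real.exp y ≤ Real.exp y * Real.cos θ := by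
    rw [mul_comm]; gcongr
  linarith

lemma Kg_deriv_le (a : ℂ) {c θ : ℝ} (h1 : |θ| ≤ 2) (h2 : c ≤ Real.cos θ) (y : ℝ) :
    ‖(a - Complex.exp (y + I * θ)) * Kg a θ y‖ ≤ Kb a c y := by
  rw [norm_mul]
  have h3 : ‖a - Complex.exp (y + I * θ)‖ ≤ ‖a‖ + Real.exp y := by
    refine (norm_sub_le _ _).trans ?_
    rw [Complex.norm_exp]; simp
  calc _ ≤ (‖a‖ + Real.exp y) * (Real.exp (|a.im| * 2) * Real.exp (a.re * y - c * Real.exp y)) := by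
        gcongr; exact Kg_norm_le a h1 h2 y
    _ = _ := by
      unfold Kb
      rw [show (a.re + 1) * y - c * Real.exp y = y + (a.re * y - c * Real.exp y) by ring, Real.exp_add y]
      ring

lemma integrable_Kg {a : ℂ} (ha : 0 < a.re) {θ : ℝ} (h : |θ| < Real.pi / 2) : Integrable (Kg a θ) := by
  have hc : 0 < Real.cos θ := Real.cos_pos_of_mem_Ioo (abs_lt.1 h)
  refine ((integrable_ge ha hc).const_mul (Real.exp (|a.im| * 2))).mono' (continuous_Kg a θ).aestronglyMeasurable ?_
  filter_upwards with y
  exact Kg_norm_le a (by linarith [Real.pi_lt_four]) le_rfl y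

lemma integral_Kg_deriv {a : ℂ} (ha : 0 < a.re) {θ : ℝ} (h : |θ| < Real.pi / 2) :
    HasDerivAt (fun θ : ℝ => ∫ y, Kg a θ y) 0 θ := by
  obtain ⟨h0, h1⟩ := exists_between h
  have hc : 0 < Real.cos h0 := Real.cos_pos_of_mem_Ioo ⟨by linarith [abs_nonneg θ], h1.2⟩
  have key : ∀ x ∈ {x : ℝ | |x| < h0}, |x| ≤ 2 ∧ Real.cos h0 ≤ Real.cos x := by
    intro x hx
    have hx' : |x| < h0 := hx
    refine ⟨by linarith [Real.pi_lt_four], ?_⟩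
    rw [← Real.cos_abs x]
    exact Real.cos_le_cos_of_nonneg_of_le_pi (abs_nonneg x) (by linarith [Real.pi_pos]) (le_of_lt hx)
  have hs : {x : ℝ | |x| < h0} ∈ 𝓝 θ := (isOpen_lt continuous_abs continuous_const).mem_nhds h1.1
  have hD := (hasDerivAt_integral_of_dominated_loc_of_deriv_le (μ := volume) (F := fun θ y => Kg a θ y)
    (F' := fun θ y => I * (a - Complex.exp (y + I * θ)) * Kg a θ y) (x₀ := θ) (bound := Kb a (Real.cos h0)) hs
    (Eventually.of_forall fun x => (continuous_Kg a x).aestronglyMeasurable) (integrable_Kg ha h)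
    (by apply Continuous.aestronglyMeasurable; have := continuous_Kg a θ; fun_prop)
    (Eventually.of_forall fun y x hx => by
      rw [mul_assoc, norm_mul, Complex.norm_I, one_mul]
      exact Kg_deriv_le a (key x hx).1 (key x hx).2 y) (integrable_Kb ha hc)
    (Eventually.of_forall fun y x hx => Kg_dθ a x y)).2
  refine HasDerivAt.congr_deriv hD ?_
  have hz := integral_eq_zero_of_hasDerivAt_of_integrable (f := Kg a θ) (fun y => Kg_dy a θ y)
    ((integrable_Kb ha hc).mono' (by apply Continuous.aestronglyMeasurable; have := continuous_Kg a θ; fun_prop)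
      (Eventually.of_forall fun y => Kg_deriv_le a (key θ h1.1).1 (key θ h1.1).2 y)) (integrable_Kg ha h)
  show ∫ y : ℝ, I * (a - Complex.exp (y + I * θ)) * Kg a θ y = (0:ℂ)
  simp_rw [mul_assoc]
  rw [integral_const_mul, hz, mul_zero]

theorem integral_Kg {a : ℂ} (ha : 0 < a.re) {θ : ℝ} (h : |θ| < Real.pi / 2) :
    ∫ y, Kg a θ y = Complex.Gamma a := by
  have hU : IsOpen {x : ℝ | |x| < Real.pi / 2} := isOpen_lt continuous_abs continuous_const
  have h0 : ∫ y, Kg a 0 y = Complex.Gamma a := by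
    rw [Complex.Gamma_eq_integral ha, Complex.GammaIntegral]
    have := mellin_log (fun x : ℝ => ((Real.exp (-x) : ℝ) : ℂ)) a
    unfold mellin at this
    simp only [smul_eq_mul, mul_comm _ (((Real.exp (-_) : ℝ) : ℂ))] at this
    rw [this]
    refine integral_congr_ae (Eventually.of_forall fun y => ?_)
    dsimp only
    unfold Kg
    rw [Complex.ofReal_exp, ← Complex.exp_add]
    congr 1
    push_cast
    simp
    ring
  rw [← h0]
  have hpre : IsPreconnected {x : ℝ | |x| < Real.pi / 2} := by
    have : {x : ℝ | |x| < Real.pi / 2} = Set.Ioo (-(Real.pi / 2)) (Real.pi / 2) := by ext x; simp [abs_lt]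
    rw [this]; exact isPreconnected_Ioo
  exact hU.is_const_of_deriv_eq_zero hpre
    (fun x hx => (integral_Kg_deriv ha hx).differentiableAt.differentiableWithinAt)
    (fun x hx => (integral_Kg_deriv ha hx).deriv) h (by simp [Real.pi_pos])

end HL

open MeasureTheory Filter Topology Asymptotics
open scoped ENNReal
namespace HL
open Complex (I)

/-- weighted derivative of the rotated Gaussian in the logarithmic variable -/
noncomputable def Bf (φ v : ℝ) : ℂ :=
  -(2 * Real.pi) * Complex.exp (I * φ) * Complex.exp ((5 / 2 : ℝ) * v - Real.pi * Complex.exp (2 * v + I * φ))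

/-- exponent used in the Gamma integral -/
noncomputable def aG (t : ℝ) : ℂ := 5 / 4 + I * t / 2

lemma aG_re (t : ℝ) : 0 < (aG t).re := by
  unfold aG; simp

lemma Bf_char (φ t v : ℝ) : Bf φ v * Complex.exp (I * t * v) =
    (-(2 * Real.pi) * Complex.exp (I * φ) * Complex.exp (- aG t * (Real.log Real.pi + I * φ))) *
      Kg (aG t) φ (2 * v + Real.log Real.pi) := by
  unfold Bf Kg
  have h : Complex.exp ((((2 * v + Real.log Real.pi : ℝ)) : ℂ) + I * φ) = Real.pi * Complex.exp (2 * v + I * φ) := by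
    have : (Real.pi : ℂ) = Complex.exp (Real.log Real.pi : ℝ) := by
      rw [← Complex.ofReal_exp, Real.exp_log Real.pi_pos]
    conv_rhs => rw [this, ← Complex.exp_add]
    congr 1; push_cast; ring
  rw [h]
  simp only [mul_assoc _ (Complex.exp _) (Complex.exp _), ← Complex.exp_add]
  congr 2
  unfold aG
  push_cast
  ring

lemma integrable_Bf {φ : ℝ} (h : |φ| < Real.pi / 2) : Integrable (Bf φ) := by
  have h1 := ((integrable_Kg (aG_re 0) h).comp_add_right (Real.log Real.pi)).comp_mul_left' (two_ne_zero (α := ℝ))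
  refine (h1.const_mul (-(2 * Real.pi) * Complex.exp (I * φ) * Complex.exp (- aG 0 * (Real.log Real.pi + I * φ)))).congr
    (Eventually.of_forall fun v => ?_)
  dsimp only
  rw [← Bf_char]; simp

lemma ft_Bf {φ : ℝ} (h : |φ| < Real.pi / 2) (t : ℝ) : ft (Bf φ) t =
    -((1 / 2 + I * t) / 2) * Complex.Gammaℝ (1 / 2 + I * t) * Complex.exp (-(I * (1 / 2 + I * t) * φ / 2)) := by
  unfold ft
  simp_rw [Bf_char]
  rw [integral_const_mul]
  have h1 : ∫ v : ℝ, Kg (aG t) φ (2 * v + Real.log Real.pi) = (1 / 2 : ℝ) * Complex.Gamma (aG t) := by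
    have := Measure.integral_comp_mul_left (fun y => Kg (aG t) φ (y + Real.log Real.pi)) 2
    rw [this, integral_add_right_eq_self (fun y => Kg (aG t) φ y), integral_Kg (aG_re t) h]
    simp
  have h2 : Complex.Gamma (aG t) = ((1 / 2 + I * t) / 2) * Complex.Gamma ((1 / 2 + I * t) / 2) := by
    rw [← Complex.Gamma_add_one]
    · congr 1; unfold aG; ring
    · intro h
      have := congrArg Complex.re h
      norm_num at this
  rw [h1, h2, Complex.Gammaℝ_def]
  have h3 : (Real.pi : ℂ) = Complex.exp (Real.log Real.pi : ℝ) := by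
    rw [← Complex.ofReal_exp, Real.exp_log Real.pi_pos]
  have h4 : (Real.pi : ℂ) ^ (-(1 / 2 + I * t) / 2) = Complex.exp (Real.log Real.pi * (-(1 / 2 + I * t) / 2)) := by
    rw [Complex.cpow_def_of_ne_zero (by exact_mod_cast Real.pi_pos.ne'), Complex.ofReal_log Real.pi_pos.le]
  rw [h4]
  have h5 : (Real.pi : ℂ) * Complex.exp (I * φ) * Complex.exp (- aG t * (Real.log Real.pi + I * φ)) =
     Complex.exp (Real.log Real.pi * (-(1 / 2 + I * t) / 2)) * Complex.exp (-(I * (1 / 2 + I * t) * φ / 2)) := by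
    conv_lhs => rw [h3]
    rw [← Complex.exp_add, ← Complex.exp_add, ← Complex.exp_add]
    congr 1
    unfold aG
    ring
  push_cast
  linear_combination (-((1 / 2 + I * t) / 2) * Complex.Gamma ((1 / 2 + I * t) / 2)) * h5

/-- the weighted Muentz remainder -/
noncomputable def Gf (φ y : ℝ) : ℂ := ∫ w, Af w * Bf φ (w + y)

lemma integrable_AB {φ : ℝ} (h : |φ| < Real.pi / 2) :
    Integrable (fun p : ℝ × ℝ => Af p.1 * Bf φ (p.1 + p.2)) (volume.prod volume) := by
  have h1 := Integrable.mul_prod integrable_Af (integrable_Bf h)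
  exact (measurePreserving_prod_add (volume : Measure ℝ) (volume : Measure ℝ)).integrable_comp_of_integrable h1

lemma integrable_Gf {φ : ℝ} (h : |φ| < Real.pi / 2) : Integrable (Gf φ) :=
  (integrable_AB h).integral_prod_right

theorem ft_Gf {φ : ℝ} (h : |φ| < Real.pi / 2) (t : ℝ) :
    ft (Gf φ) t = ft Af (-t) * ft (Bf φ) t := by
  unfold ft Gf
  have e : ∀ y : ℝ, (∫ w, Af w * Bf φ (w + y)) * Complex.exp (I * t * y) =
      ∫ w, Af w * Bf φ (w + y) * Complex.exp (I * t * y) := fun y => (integral_mul_const _ _).symm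
  simp_rw [e]
  have hI : Integrable (fun p : ℝ × ℝ => Af p.1 * Bf φ (p.1 + p.2) * Complex.exp (I * t * p.2)) (volume.prod volume) := by
    refine (integrable_AB h).mul_bdd (c := 1) (by apply Continuous.aestronglyMeasurable; fun_prop) ?_
    filter_upwards with p
    exact (norm_char t p.2).le
  have hs := integral_integral_swap (f := fun w y : ℝ => Af w * Bf φ (w + y) * Complex.exp (I * t * y)) hI
  rw [← hs, ← integral_mul_const]
  refine integral_congr_ae (Eventually.of_forall fun w => ?_)
  dsimp only
  simp_rw [mul_assoc]
  rw [integral_const_mul]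
  congr 1
  have := integral_add_left_eq_self (μ := volume) (fun y => Bf φ y * Complex.exp (I * t * (y - w))) w
  rw [← integral_const_mul]
  simp only [mul_assoc] at this
  refine Eq.trans ?_ (this.trans ?_)
  · refine integral_congr_ae (Eventually.of_forall fun y => ?_)
    dsimp only
    push_cast
    congr 3; ring
  · refine integral_congr_ae (Eventually.of_forall fun y => ?_)
    dsimp only
    rw [mul_left_comm (Complex.exp _), ← Complex.exp_add]
    congr 2; push_cast; ring

theorem ft_Gf' {φ : ℝ} (h : |φ| < Real.pi / 2) (t : ℝ) :
    ft (Gf φ) t = 1 / 2 * completedRiemannZeta (1 / 2 + I * t) * Complex.exp (-(I * (1 / 2 + I * t) * φ / 2)) := by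
  have h0 : (1 / 2 + I * t) ≠ 0 := by
    intro h
    have := congrArg Complex.re h
    norm_num at this
  have hG : Complex.Gammaℝ (1 / 2 + I * t) ≠ 0 := by
    apply Complex.Gammaℝ_ne_zero_of_re_pos; simp
  have hz : completedRiemannZeta (1 / 2 + I * t) = riemannZeta (1 / 2 + I * t) * Complex.Gammaℝ (1 / 2 + I * t) := by
    rw [riemannZeta_def_of_ne_zero h0, div_mul_cancel₀ _ hG]
  rw [ft_Gf h, ft_Bf h, hz, ft_Af]
  field_simp

end HL

open MeasureTheory Filter Topology Asymptotics
open scoped ENNReal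
namespace HL
open Complex (I)

/-- complex Gaussian -/
noncomputable def hg (b : ℂ) (u : ℝ) : ℂ := Complex.exp (-b * (u:ℂ) ^ 2)
/-- derivative of the complex Gaussian -/
noncomputable def hg' (b : ℂ) (u : ℝ) : ℂ := -(2 * b) * (u * Complex.exp (-b * (u:ℂ) ^ 2))

lemma hg_deriv (b : ℂ) (u : ℝ) : HasDerivAt (hg b) (hg' b u) u := by
  have h0 : HasDerivAt (fun u : ℝ => (u:ℂ)) 1 u := Complex.ofRealCLM.hasDerivAt
  refine HasDerivAt.congr_deriv (((h0.pow 2).const_mul (-b)).cexp) ?_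
  simp only [hg', Pi.pow_apply]
  push_cast
  ring

lemma continuous_hg (b : ℂ) : Continuous (hg b) := by unfold hg; fun_prop
lemma continuous_hg' (b : ℂ) : Continuous (hg' b) := by unfold hg'; fun_prop

lemma norm_hg (b : ℂ) (u : ℝ) : ‖hg b u‖ = Real.exp (-b.re * u ^ 2) := by
  unfold hg
  rw [Complex.norm_exp]
  congr 1
  rw [show ((u:ℂ)^2) = ((u^2 : ℝ) : ℂ) by push_cast; ring, Complex.re_mul_ofReal]
  simp

lemma summable_gauss {c : ℝ} (hc : 0 < c) : Summable (fun n : ℕ => Real.exp (-c * ((n:ℝ) + 1) ^ 2)) := by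
  have h1 : Summable (fun n : ℕ => Real.exp (n * (-c))) := Real.summable_exp_nat_mul_iff.2 (by linarith)
  refine Summable.of_nonneg_of_le (fun n => (Real.exp_pos _).le) (fun n => ?_) h1
  apply Real.exp_le_exp.2
  have : (0:ℝ) ≤ n := Nat.cast_nonneg n
  nlinarith [mul_nonneg hc.le this, mul_nonneg hc.le (mul_nonneg this this)]

lemma summable_hg {b : ℂ} (hb : 0 < b.re) : Summable (fun n : ℕ => hg b ((n:ℝ) + 1)) := by
  apply Summable.of_norm
  simp_rw [norm_hg]
  exact summable_gauss hb

lemma gauss_piece (b : ℂ) (k : ℕ) :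
    ∫ u in (k:ℝ)..((k + 1 : ℕ) : ℝ), frc u * hg' b u = hg b ((k:ℝ) + 1) - ∫ u in (k:ℝ)..((k + 1 : ℕ) : ℝ), hg b u := by
  have h1 : ∫ u in (k:ℝ)..((k + 1 : ℕ) : ℝ), frc u * hg' b u = ∫ u in (k:ℝ)..((k + 1 : ℕ) : ℝ), ((u:ℂ) - k) * hg' b u := by
    rw [intervalIntegral.integral_of_le (by push_cast; linarith), intervalIntegral.integral_of_le (by push_cast; linarith),
      integral_Ioc_eq_integral_Ioo, integral_Ioc_eq_integral_Ioo]
    refine setIntegral_congr_fun measurableSet_Ioo fun u hu => ?_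
    congr 1
    unfold frc
    have : ⌊u⌋ = (k:ℤ) := by
      rw [Int.floor_eq_iff]; push_cast
      have := hu.2; push_cast at this
      exact ⟨hu.1.le, this⟩
    rw [← Int.self_sub_floor, this]
    push_cast; rfl
  have h2 : ∫ u in (k:ℝ)..((k + 1 : ℕ) : ℝ), (hg b u + ((u:ℂ) - k) * hg' b u) = hg b ((k:ℝ) + 1) := by
    have := intervalIntegral.integral_eq_sub_of_hasDerivAt (a := (k:ℝ)) (b := ((k + 1 : ℕ) : ℝ))
      (f := fun u : ℝ => ((u:ℂ) - k) * hg b u) (f' := fun u : ℝ => hg b u + ((u:ℂ) - k) * hg' b u)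
      (fun u _ => by
        have h0 : HasDerivAt (fun u : ℝ => (u:ℂ) - k) 1 u := Complex.ofRealCLM.hasDerivAt.sub_const (k:ℂ)
        refine HasDerivAt.congr_deriv (h0.mul (hg_deriv b u)) ?_
        ring)
      (by
        apply Continuous.intervalIntegrable
        have := continuous_hg b; have := continuous_hg' b; fun_prop)
    rw [this]; push_cast; ring
  rw [intervalIntegral.integral_add] at h2
  · rw [h1, ← h2]; ring
  · exact (continuous_hg b).intervalIntegrable _ _
  · apply Continuous.intervalIntegrable
    have := continuous_hg' b; fun_prop

lemma integrable_hg' {b : ℂ} (hb : 0 < b.re) : Integrable (hg' b) :=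
  (integrable_mul_cexp_neg_mul_sq hb).const_mul _

theorem gauss_abel {b : ℂ} (hb : 0 < b.re) :
    ∫ u in Set.Ioi (0:ℝ), frc u * hg' b u = ∑' n : ℕ, hg b ((n:ℝ) + 1) - (Real.pi / b) ^ (1 / 2 : ℂ) / 2 := by
  have hI : IntegrableOn (fun u => frc u * hg' b u) (Set.Ioi 0) :=
    ((integrable_hg' hb).bdd_mul (c := 1) measurable_frc.aestronglyMeasurable
      (Eventually.of_forall frc_norm_le)).integrableOn
  have t1 := intervalIntegral_tendsto_integral_Ioi 0 hI (tendsto_natCast_atTop_atTop (R := ℝ))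
  have hI2 : IntegrableOn (hg b) (Set.Ioi 0) := (integrable_cexp_neg_mul_sq hb).integrableOn
  have t2 := intervalIntegral_tendsto_integral_Ioi 0 hI2 (tendsto_natCast_atTop_atTop (R := ℝ))
  have t3 := (summable_hg hb).hasSum.tendsto_sum_nat
  have hG : ∫ u in Set.Ioi (0:ℝ), hg b u = (Real.pi / b) ^ (1 / 2 : ℂ) / 2 := integral_gaussian_complex_Ioi hb
  rw [← hG]
  refine tendsto_nhds_unique t1 ((t3.sub t2).congr fun N => ?_)
  have e1 := intervalIntegral.sum_integral_adjacent_intervals (μ := volume) (f := fun u => frc u * hg' b u)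
    (a := fun n : ℕ => (n:ℝ)) (n := N) (fun k _ => by
      refine IntervalIntegrable.mono_fun ((continuous_hg' b).intervalIntegrable _ _)
        (measurable_frc.mul (continuous_hg' b).measurable).aestronglyMeasurable ?_
      filter_upwards with u
      rw [norm_mul]
      exact mul_le_of_le_one_left (norm_nonneg _) (frc_norm_le u))
  have e2 := intervalIntegral.sum_integral_adjacent_intervals (μ := volume) (f := hg b)
    (a := fun n : ℕ => (n:ℝ)) (n := N) (fun k _ => (continuous_hg b).intervalIntegrable _ _)
  simp only [Nat.cast_zero] at e1 e2
  rw [← e1, ← e2, ← Finset.sum_sub_distrib]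
  exact Finset.sum_congr rfl fun k _ => (gauss_piece b k).symm

/-- quadratic coefficient -/
noncomputable def bq (φ y : ℝ) : ℂ := Real.pi * Complex.exp (2 * y + I * φ)

lemma bq_re (φ y : ℝ) : (bq φ y).re = Real.pi * Real.exp (2 * y) * Real.cos φ := by
  unfold bq
  simp [Complex.exp_re]; ring

lemma bq_re_pos {φ : ℝ} (h : |φ| < Real.pi / 2) (y : ℝ) : 0 < (bq φ y).re := by
  rw [bq_re]
  have hc : 0 < Real.cos φ := Real.cos_pos_of_mem_Ioo (abs_lt.1 h)
  have := Real.pi_pos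
  positivity

/-- the theta series -/
noncomputable def psi (φ y : ℝ) : ℂ := ∑' n : ℕ, hg (bq φ y) ((n:ℝ) + 1)

theorem Gf_eq {φ : ℝ} (h : |φ| < Real.pi / 2) (y : ℝ) :
    Gf φ y = Complex.exp (y / 2) * (psi φ y - Complex.exp (-(y + I * φ / 2)) / 2) := by
  have h1 : (Real.pi / bq φ y) ^ (1 / 2 : ℂ) = Complex.exp (-(y + I * φ / 2)) := by
    have : (Real.pi / bq φ y) = Complex.exp (-(2 * y + I * φ)) := by
      unfold bq
      rw [Complex.exp_neg]
      have : (Real.pi : ℂ) ≠ 0 := by exact_mod_cast Real.pi_pos.ne'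
      field_simp
    rw [this, Complex.cpow_def_of_ne_zero (Complex.exp_ne_zero _), Complex.log_exp]
    · congr 1; ring
    · have := (abs_lt.1 h); simp; linarith [this.2]
    · have := (abs_lt.1 h); simp; linarith [this.1, Real.pi_pos]
  rw [← h1]
  unfold psi
  rw [← gauss_abel (bq_re_pos h y)]
  have h2 := mellin_log (fun u => frc u * hg' (bq φ y) u) 1
  unfold mellin at h2
  simp only [sub_self, Complex.cpow_zero, one_smul, one_mul] at h2
  rw [h2]
  unfold Gf
  rw [← integral_const_mul]
  refine integral_congr_ae (Eventually.of_forall fun w => ?_)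
  dsimp only
  unfold Af Bf hg' bq
  have e1 : ∀ u v : ℂ, Complex.exp (2 * (u + v) + I * φ) = Complex.exp (2 * v + I * φ) * Complex.exp u ^ 2 := by
    intro u v
    rw [← Complex.exp_nat_mul, ← Complex.exp_add]; congr 1; push_cast; ring
  push_cast
  rw [e1, sub_eq_add_neg, Complex.exp_add (5 / 2 * ((w:ℂ) + y))]
  have e2 : Complex.exp (-(w:ℂ) / 2) * Complex.exp (I * φ) * Complex.exp (5 / 2 * ((w:ℂ) + y)) =
     Complex.exp (y / 2) * Complex.exp (2 * y + I * φ) * Complex.exp w * Complex.exp w := by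
    simp only [← Complex.exp_add]; congr 1; ring
  rw [show -(Real.pi * Complex.exp (2 * y + I * φ)) * Complex.exp w ^ 2 =
    -(Real.pi * (Complex.exp (2 * y + I * φ) * Complex.exp w ^ 2)) by ring]
  linear_combination (-2 * Real.pi * frc (Real.exp w) * Complex.exp (-(Real.pi * (Complex.exp (2 * y + I * φ) * Complex.exp w ^ 2)))) * e2

end HL

open MeasureTheory Filter Topology Asymptotics
open scoped ENNReal
namespace HL
open Complex (I)

lemma tsum_int_hg {b : ℂ} (hb : 0 < b.re) : ∑' n : ℤ, Complex.exp (-b * (n:ℂ) ^ 2) = 1 + 2 * ∑' n : ℕ, hg b ((n:ℝ) + 1) := by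
  have e1 : ∀ n : ℕ, Complex.exp (-b * (((n:ℤ) + 1 : ℤ) : ℂ) ^ 2) = hg b ((n:ℝ) + 1) := by
    intro n; unfold hg; push_cast; rfl
  have e2 : ∀ n : ℕ, Complex.exp (-b * ((-((n:ℤ) + 1) : ℤ) : ℂ) ^ 2) = hg b ((n:ℝ) + 1) := by
    intro n; unfold hg; push_cast; rw [neg_sq]
  rw [tsum_of_add_one_of_neg_add_one (f := fun n : ℤ => Complex.exp (-b * (n:ℂ) ^ 2))]
  · simp only [e1, e2]; simp; ring
  · simp only [e1]; exact summable_hg hb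
  · simp only [e2]; exact summable_hg hb

lemma psi_conj (φ y : ℝ) : starRingEnd ℂ (psi φ y) = ∑' n : ℕ, hg (Real.pi * Complex.exp (2 * y - I * φ)) ((n:ℝ) + 1) := by
  unfold psi
  rw [Complex.conj_tsum]
  congr 1; ext n
  unfold hg bq
  rw [← Complex.exp_conj]
  congr 1
  simp only [map_mul, map_neg, map_pow, ← Complex.exp_conj, map_add, Complex.conj_ofReal, Complex.conj_I, map_ofNat]
  congr 4; ring

theorem psi_functional {φ : ℝ} (h : |φ| < Real.pi / 2) (y : ℝ) :
    1 + 2 * psi φ y = Complex.exp (-(y + I * φ / 2)) * (1 + 2 * starRingEnd ℂ (psi φ (-y))) := by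
  have ha : 0 < (Complex.exp (2 * y + I * φ)).re := by
    have := bq_re_pos h y
    unfold bq at this
    rw [Complex.re_ofReal_mul] at this
    exact pos_of_mul_pos_right this Real.pi_pos.le
  have ht := Complex.tsum_exp_neg_mul_int_sq ha
  have h1 : Complex.exp (2 * y + I * φ) ^ (1 / 2 : ℂ) = Complex.exp ((y + I * φ / 2)) := by
    rw [Complex.cpow_def_of_ne_zero (Complex.exp_ne_zero _), Complex.log_exp]
    · congr 1; ring
    · have := (abs_lt.1 h); simp; linarith [this.1, Real.pi_pos]
    · have := (abs_lt.1 h); simp; linarith [this.2, Real.pi_pos]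
  rw [h1, one_div, ← Complex.exp_neg] at ht
  have h2 : ∑' n : ℤ, Complex.exp (-Real.pi * Complex.exp (2 * y + I * φ) * (n:ℂ) ^ 2) = 1 + 2 * psi φ y := by
    have := tsum_int_hg (bq_re_pos h y)
    unfold psi
    rw [← this]
    unfold bq
    congr 1; ext n; congr 2; ring
  have h3 : ∑' n : ℤ, Complex.exp (-Real.pi / Complex.exp (2 * y + I * φ) * (n:ℂ) ^ 2) = 1 + 2 * starRingEnd ℂ (psi φ (-y)) := by
    have hre : 0 < ((Real.pi : ℂ) * Complex.exp (2 * (-y : ℝ) - I * φ)).re := by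
      have := bq_re_pos (φ := -φ) (by rwa [abs_neg]) (-y)
      unfold bq at this
      convert this using 4
      push_cast; ring
    rw [psi_conj, ← tsum_int_hg hre]
    congr 1; ext n; congr 2
    rw [show (2 * ((-y : ℝ) : ℂ) - I * φ) = -(2 * y + I * φ) by push_cast; ring, Complex.exp_neg]
    ring
  rw [h2, h3] at ht
  exact ht

theorem Gf_symm {φ : ℝ} (h : |φ| < Real.pi / 2) (y : ℝ) : ‖Gf φ (-y)‖ = ‖Gf φ y‖ := by
  rw [← Complex.norm_conj (Gf φ (-y))]
  have e : starRingEnd ℂ (Gf φ (-y)) = Complex.exp (I * φ / 2) * Gf φ y := by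
    have hf := psi_functional h y
    have hP : starRingEnd ℂ (psi φ (-y)) = Complex.exp (y + I * φ / 2) * (psi φ y + 1 / 2) - 1 / 2 := by
      have hm : Complex.exp (y + I * φ / 2) * Complex.exp (-(y + I * φ / 2)) = 1 := by
        rw [← Complex.exp_add]; simp
      linear_combination (-Complex.exp (y + I * φ / 2) / 2) * hf - (1 / 2 + starRingEnd ℂ (psi φ (-y))) * hm
    rw [Gf_eq h, Gf_eq h, map_mul, map_sub, hP]
    have c1 : starRingEnd ℂ (Complex.exp (((-y : ℝ) : ℂ) / 2)) = Complex.exp (-(y:ℂ) / 2) := by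
      rw [← Complex.exp_conj]; congr 1; simp [Complex.conj_ofNat]
    have c2 : starRingEnd ℂ (Complex.exp (-(((-y : ℝ) : ℂ) + I * φ / 2)) / 2) = Complex.exp (y + I * φ / 2) / 2 := by
      rw [map_div₀, ← Complex.exp_conj]; congr 2
      · simp [Complex.conj_ofNat]; ring
      · exact Complex.conj_ofNat 2
    rw [c1, c2]
    have a1 : Complex.exp (-(y:ℂ) / 2) * Complex.exp (y + I * φ / 2) = Complex.exp (I * φ / 2) * Complex.exp (y / 2) := by
      simp only [← Complex.exp_add]; congr 1; ring
    have a2 : Complex.exp (-(y:ℂ) / 2) = Complex.exp (I * φ / 2) * (Complex.exp (y / 2) * Complex.exp (-(y + I * φ / 2))) := by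
      simp only [← Complex.exp_add]; congr 1; ring
    linear_combination psi φ y * a1 - 1 / 2 * a2
  rw [e, norm_mul, Complex.norm_exp]
  simp

end HL

open MeasureTheory Filter Topology Asymptotics
open scoped ENNReal
namespace HL
open Complex (I)

/-- amplitude in the oscillatory integral -/
noncomputable def Pa (H κ y : ℝ) : ℝ := W H y * Real.exp (-y - κ * Real.exp (2 * y))
/-- its derivative -/
noncomputable def Pa' (H κ y : ℝ) : ℝ :=
  -(16 * H ^ 4 * y / (4 + H ^ 2 * y ^ 2) ^ 2) * Real.exp (-y - κ * Real.exp (2 * y))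
    + W H y * (Real.exp (-y - κ * Real.exp (2 * y)) * (-1 - κ * (Real.exp (2 * y) * 2)))
/-- phase -/
noncomputable def Qa (A y : ℝ) : ℂ := Complex.exp (-(I * A * Real.exp (2 * y)))

lemma W_den_pos (H y : ℝ) : 0 < 4 + H ^ 2 * y ^ 2 := by positivity

lemma continuous_W (H : ℝ) : Continuous (W H) := by
  unfold W
  exact Continuous.div (by fun_prop) (by fun_prop) (fun y => (W_den_pos H y).ne')

lemma W_deriv (H y : ℝ) : HasDerivAt (W H) (-(16 * H ^ 4 * y / (4 + H ^ 2 * y ^ 2) ^ 2)) y := by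
  have h1 : HasDerivAt (fun y : ℝ => 4 + H ^ 2 * y ^ 2) (H ^ 2 * (2 * y)) y := by
    have := ((hasDerivAt_pow 2 y).const_mul (H ^ 2)).const_add 4
    simpa using this
  have h2 := (hasDerivAt_const y (8 * H ^ 2)).div h1 (W_den_pos H y).ne'
  refine HasDerivAt.congr_deriv h2 ?_
  have := (W_den_pos H y).ne'
  field_simp
  ring

lemma exp2_deriv (y : ℝ) : HasDerivAt (fun y : ℝ => Real.exp (2 * y)) (Real.exp (2 * y) * 2) y := by
  have := ((hasDerivAt_id y).const_mul 2).exp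
  simpa using this

lemma Pa_deriv (H κ y : ℝ) : HasDerivAt (Pa H κ) (Pa' H κ y) y := by
  have h1 : HasDerivAt (fun y : ℝ => -y - κ * Real.exp (2 * y)) (-1 - κ * (Real.exp (2 * y) * 2)) y :=
    (hasDerivAt_neg y).sub ((exp2_deriv y).const_mul κ)
  exact (W_deriv H y).mul h1.exp

lemma Qa_deriv (A y : ℝ) : HasDerivAt (Qa A) (-(2 * I * A) * Real.exp (2 * y) * Qa A y) y := by
  have h1 := (((exp2_deriv y).ofReal_comp).const_mul (I * A)).neg.cexp
  refine HasDerivAt.congr_deriv h1 ?_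
  simp only [Qa, Pi.neg_apply]
  push_cast
  ring

lemma norm_Qa (A y : ℝ) : ‖Qa A y‖ = 1 := by
  unfold Qa
  rw [show -(I * (A:ℂ) * (Real.exp (2 * y) : ℝ)) = ((-(A * Real.exp (2 * y)) : ℝ) : ℂ) * I by push_cast; ring]
  exact Complex.norm_exp_ofReal_mul_I _

lemma continuous_Pa' (H κ : ℝ) : Continuous (Pa' H κ) := by
  unfold Pa'
  have h1 : Continuous (fun y : ℝ => 16 * H ^ 4 * y / (4 + H ^ 2 * y ^ 2) ^ 2) :=
    Continuous.div (by fun_prop) (by fun_prop) (fun y => pow_ne_zero 2 (W_den_pos H y).ne')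
  have h2 := continuous_W H
  fun_prop

lemma continuous_Pa (H κ : ℝ) : Continuous (Pa H κ) := by
  unfold Pa
  have h2 := continuous_W H
  fun_prop

lemma continuous_Qa (A : ℝ) : Continuous (Qa A) := by
  unfold Qa; fun_prop

lemma Pa_nonneg (H κ y : ℝ) : 0 ≤ Pa H κ y := mul_nonneg (W_nonneg _ _) (Real.exp_pos _).le

lemma Pa'_nonpos (H : ℝ) {κ y : ℝ} (hκ : 0 ≤ κ) (hy : 0 ≤ y) : Pa' H κ y ≤ 0 := by
  unfold Pa'
  have h1 : 0 ≤ 16 * H ^ 4 * y / (4 + H ^ 2 * y ^ 2) ^ 2 := by positivity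
  have h2 := Real.exp_pos (-y - κ * Real.exp (2 * y))
  have h3 := W_nonneg H y
  have h4 : 0 ≤ κ * (Real.exp (2 * y) * 2) := by positivity
  have h5 := mul_nonneg h1 h2.le
  have h6 := mul_nonneg h3 (mul_nonneg h2.le (by linarith : 0 ≤ 1 + κ * (Real.exp (2 * y) * 2)))
  nlinarith

lemma Pa_zero (H κ : ℝ) : Pa H κ 0 = 2 * H ^ 2 * Real.exp (-κ) := by
  unfold Pa W; simp; ring

theorem osc_bound (H : ℝ) {κ A R : ℝ} (hκ : 0 ≤ κ) (hA : A ≠ 0) (hR : 0 ≤ R) :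
    ‖∫ y in (0:ℝ)..R, ((W H y * Real.exp y * Real.exp (-(κ * Real.exp (2 * y))) : ℝ) : ℂ) * Qa A y‖
      ≤ 2 * H ^ 2 * Real.exp (-κ) / |A| := by
  have hne : (-(2 * I * A)) ≠ 0 := by
    simp [hA]
  have e : ∀ y : ℝ, ((W H y * Real.exp y * Real.exp (-(κ * Real.exp (2 * y))) : ℝ) : ℂ) * Qa A y =
      (-(2 * I * A))⁻¹ * (((Pa H κ y : ℝ) : ℂ) * (-(2 * I * A) * Real.exp (2 * y) * Qa A y)) := by
    intro y
    have : W H y * Real.exp y * Real.exp (-(κ * Real.exp (2 * y))) = Pa H κ y * Real.exp (2 * y) := by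
      unfold Pa
      rw [mul_assoc, mul_assoc, ← Real.exp_add, ← Real.exp_add]
      congr 2; ring
    have hAc : (A:ℂ) ≠ 0 := by exact_mod_cast hA
    rw [this]
    push_cast
    field_simp
  simp_rw [e]
  rw [intervalIntegral.integral_const_mul, norm_mul]
  have hp := intervalIntegral.integral_mul_deriv_eq_deriv_mul (a := 0) (b := R)
    (u := fun y => ((Pa H κ y : ℝ) : ℂ)) (v := Qa A) (u' := fun y => ((Pa' H κ y : ℝ) : ℂ))
    (v' := fun y => -(2 * I * A) * Real.exp (2 * y) * Qa A y)
    (fun y _ => (Pa_deriv H κ y).ofReal_comp) (fun y _ => Qa_deriv A y)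
    (by apply Continuous.intervalIntegrable; have := continuous_Pa' H κ; fun_prop)
    (by apply Continuous.intervalIntegrable; have := continuous_Qa A; fun_prop)
  have h3 : ‖∫ y in (0:ℝ)..R, ((Pa' H κ y : ℝ) : ℂ) * Qa A y‖ ≤ Pa H κ 0 - Pa H κ R := by
    have i1 := intervalIntegral.integral_eq_sub_of_hasDerivAt (a := 0) (b := R) (fun y _ => Pa_deriv H κ y)
      ((continuous_Pa' H κ).intervalIntegrable _ _)
    calc _ ≤ ∫ y in (0:ℝ)..R, ‖((Pa' H κ y : ℝ) : ℂ) * Qa A y‖ := intervalIntegral.norm_integral_le_integral_norm hR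
      _ = ∫ y in (0:ℝ)..R, - Pa' H κ y := by
          apply intervalIntegral.integral_congr
          intro y hy
          rw [Set.uIcc_of_le hR] at hy
          dsimp only
          rw [norm_mul, norm_Qa, mul_one, Complex.norm_real, Real.norm_of_nonpos (Pa'_nonpos H hκ hy.1)]
      _ = _ := by rw [intervalIntegral.integral_neg, i1]; ring
  have h4 : ‖∫ y in (0:ℝ)..R, ((Pa H κ y : ℝ) : ℂ) * (-(2 * I * A) * Real.exp (2 * y) * Qa A y)‖ ≤ 2 * Pa H κ 0 := by
    rw [hp]
    refine (norm_sub_le _ _).trans ?_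
    have := norm_sub_le (((Pa H κ R : ℝ) : ℂ) * Qa A R) (((Pa H κ 0 : ℝ) : ℂ) * Qa A 0)
    rw [norm_mul, norm_mul, norm_Qa, norm_Qa, Complex.norm_real, Complex.norm_real,
      Real.norm_of_nonneg (Pa_nonneg _ _ _), Real.norm_of_nonneg (Pa_nonneg _ _ _)] at this
    linarith
  have h5 : ‖(-(2 * I * (A:ℂ)))⁻¹‖ = (2 * |A|)⁻¹ := by
    simp
  rw [h5]
  have hA' : 0 < |A| := abs_pos.2 hA
  calc _ ≤ (2 * |A|)⁻¹ * (2 * Pa H κ 0) := by gcongr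
    _ = _ := by rw [Pa_zero]; field_simp

end HL

open MeasureTheory Filter Topology Asymptotics
open scoped ENNReal
namespace HL
open Complex (I)

/-- first constant -/
noncomputable def K1 : ℝ := ∑' k : ℤ, |(k:ℝ)| ^ (-(3/2) : ℝ)
/-- second constant -/
noncomputable def K2 : ℝ := ∑' m : ℕ, ((m:ℝ) + 1) ^ (-(5/4) : ℝ)

lemma K1_nonneg : 0 ≤ K1 := tsum_nonneg fun k => Real.rpow_nonneg (abs_nonneg _) _
lemma K2_nonneg : 0 ≤ K2 := tsum_nonneg fun k => Real.rpow_nonneg (by positivity) _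

lemma summable_K2 : Summable (fun m : ℕ => ((m:ℝ) + 1) ^ (-(5/4) : ℝ)) := by
  have := (summable_nat_add_iff 1).2 (Real.summable_nat_rpow.2 (by norm_num : (-(5/4) : ℝ) < -1))
  simpa using this

lemma exp_le_rpow {v : ℝ} (hv : 0 < v) : Real.exp (-v) ≤ v ^ (-(3/8) : ℝ) := by
  rw [Real.exp_neg, Real.rpow_neg hv.le]
  apply inv_anti₀ (by positivity)
  have h1 := Real.add_one_le_exp v
  rcases le_total v 1 with h | h
  · have := Real.rpow_le_one hv.le h (by norm_num : (0:ℝ) ≤ 3/8)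
    linarith
  · have := Real.rpow_le_rpow_of_exponent_le h (by norm_num : (3/8:ℝ) ≤ 1)
    rw [Real.rpow_one] at this
    linarith

lemma off_term {δ M d S : ℝ} (hδ : 0 < δ) (hM : 0 < M) (hd : 0 < d) (h1 : d ≤ S) (h2 : M ≤ S) :
    Real.exp (-(δ * M ^ 2)) / (d * S) ≤ δ ^ (-(3/8) : ℝ) * (M ^ (-(5/4) : ℝ) * d ^ (-(3/2) : ℝ)) := by
  have hS : 0 < S := hd.trans_le h1
  have e1 : Real.exp (-(δ * M ^ 2)) ≤ δ ^ (-(3/8) : ℝ) * M ^ (((2:ℕ):ℝ) * -(3/8) : ℝ) :=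
    (exp_le_rpow (mul_pos hδ (pow_pos hM 2))).trans_eq (by
      rw [Real.mul_rpow hδ.le (by positivity), ← Real.rpow_natCast M 2, ← Real.rpow_mul hM.le])
  have e2 : (d * S)⁻¹ ≤ d ^ (-(3/2) : ℝ) * M ^ (-(1/2) : ℝ) := by
    have : d ^ (-(3/2) : ℝ) * M ^ (-(1/2) : ℝ) = (d * (d ^ (1/2 : ℝ) * M ^ (1/2:ℝ)))⁻¹ := by
      rw [mul_inv, mul_inv, ← Real.rpow_neg hd.le, ← Real.rpow_neg hM.le, ← mul_assoc]
      congr 1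
      rw [← Real.rpow_neg_one d, ← Real.rpow_add hd]; norm_num
    rw [this]
    apply inv_anti₀ (by positivity)
    apply mul_le_mul_of_nonneg_left _ hd.le
    calc d ^ (1/2 : ℝ) * M ^ (1/2:ℝ) ≤ S ^ (1/2:ℝ) * S ^ (1/2:ℝ) := by gcongr
      _ = S := by rw [← Real.rpow_add hS]; norm_num
  rw [div_eq_mul_inv]
  calc _ ≤ (δ ^ (-(3/8) : ℝ) * M ^ (((2:ℕ):ℝ) * -(3/8) : ℝ)) * (d ^ (-(3/2) : ℝ) * M ^ (-(1/2) : ℝ)) := by gcongr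
    _ = _ := by
      rw [show (-(5/4) : ℝ) = ((2:ℕ):ℝ) * -(3/8) + -(1/2) by norm_num, Real.rpow_add hM]; ring

lemma off_sum {δ : ℝ} (hδ : 0 < δ) (N : ℕ) :
    ∑ m ∈ Finset.range N, ∑ n ∈ Finset.range N, (if m = n then 0 else
      Real.exp (-(δ * ((m:ℝ) + 1) ^ 2)) / |((m:ℝ) + 1) ^ 2 - ((n:ℝ) + 1) ^ 2|) ≤ δ ^ (-(3/8) : ℝ) * (K1 * K2) := by
  have hs : Summable (fun k : ℤ => |(k:ℝ)| ^ (-(3/2) : ℝ)) := Real.summable_abs_int_rpow (by norm_num)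
  calc _ ≤ ∑ m ∈ Finset.range N, ∑ n ∈ Finset.range N, δ ^ (-(3/8) : ℝ) * (((m:ℝ) + 1) ^ (-(5/4) : ℝ) * |(((n:ℤ) - (m:ℤ) : ℤ):ℝ)| ^ (-(3/2) : ℝ)) := by
        refine Finset.sum_le_sum fun m _ => Finset.sum_le_sum fun n _ => ?_
        split_ifs with h
        · positivity
        · have hm : (0:ℝ) ≤ m := Nat.cast_nonneg m
          have hn : (0:ℝ) ≤ n := Nat.cast_nonneg n
          have e : |((m:ℝ) + 1) ^ 2 - ((n:ℝ) + 1) ^ 2| = |(((n:ℤ) - (m:ℤ) : ℤ):ℝ)| * ((m:ℝ) + 1 + (n + 1)) := by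
            rw [show ((m:ℝ) + 1) ^ 2 - ((n:ℝ) + 1) ^ 2 = -(((n:ℝ) - m) * ((m:ℝ) + 1 + (n + 1))) by ring, abs_neg, abs_mul,
              abs_of_pos (by positivity : 0 < (m:ℝ) + 1 + (n + 1))]
            push_cast; rfl
          rw [e]
          apply off_term hδ (by positivity)
          · rw [abs_pos]
            have : (n:ℤ) - m ≠ 0 := by omega
            exact_mod_cast this
          · push_cast
            rw [abs_le]; constructor <;> linarith
          · linarith
    _ = δ ^ (-(3/8) : ℝ) * ∑ m ∈ Finset.range N, ((m:ℝ) + 1) ^ (-(5/4) : ℝ) * ∑ n ∈ Finset.range N, |(((n:ℤ) - (m:ℤ) : ℤ):ℝ)| ^ (-(3/2) : ℝ) := by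
        simp_rw [Finset.mul_sum]
    _ ≤ δ ^ (-(3/8) : ℝ) * ∑ m ∈ Finset.range N, ((m:ℝ) + 1) ^ (-(5/4) : ℝ) * K1 := by
        gcongr with m _
        have inj : Function.Injective (fun n : ℕ => (n:ℤ) - (m:ℤ)) := by
          intro a b h
          have : (a:ℤ) - m = b - m := h
          omega
        calc _ ≤ ∑' n : ℕ, |(((n:ℤ) - (m:ℤ) : ℤ):ℝ)| ^ (-(3/2) : ℝ) :=
              (hs.comp_injective inj).sum_le_tsum _ (fun n _ => by positivity)
          _ ≤ K1 := tsum_comp_le_tsum_of_inj hs (fun k => by positivity) inj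
    _ ≤ δ ^ (-(3/8) : ℝ) * (K1 * K2) := by
        rw [← Finset.sum_mul, mul_comm _ K1]
        gcongr
        · exact K1_nonneg
        · exact summable_K2.sum_le_tsum _ (fun n _ => by positivity)

lemma diag_sum {c : ℝ} (hc : 0 < c) (N : ℕ) :
    ∑ n ∈ Finset.range N, Real.exp (-c * ((n:ℝ) + 1) ^ 2) ≤ Real.sqrt (Real.pi / c) / 2 := by
  have h1 : AntitoneOn (fun x : ℝ => Real.exp (-c * x ^ 2)) (Set.Icc (0:ℝ) (0 + (N:ℝ))) := by
    intro x hx y hy hxy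
    apply Real.exp_le_exp.2
    have : x ^ 2 ≤ y ^ 2 := pow_le_pow_left₀ hx.1 hxy 2
    nlinarith
  have h2 := h1.sum_le_integral
  have hI := integrable_exp_neg_mul_sq hc
  rw [← integral_gaussian_Ioi]
  calc _ = ∑ i ∈ Finset.range N, Real.exp (-c * (0 + ((i + 1 : ℕ) : ℝ)) ^ 2) := by
        refine Finset.sum_congr rfl fun i _ => ?_
        push_cast; congr 3; ring
    _ ≤ _ := h2
    _ ≤ _ := by
      rw [intervalIntegral.integral_of_le (by positivity)]
      refine setIntegral_mono_set hI.integrableOn ?_ ?_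
      · filter_upwards with x; exact (Real.exp_pos _).le
      · exact Eventually.of_forall Set.Ioc_subset_Ioi_self

lemma W_integral (H : ℝ) (hH : 0 ≤ H) (R : ℝ) : ∫ y in (0:ℝ)..R, W H y ≤ 2 * Real.pi * H := by
  have hd : ∀ y : ℝ, HasDerivAt (fun y => 4 * H * Real.arctan (H / 2 * y)) (W H y) y := by
    intro y
    have h1 := (((hasDerivAt_id y).const_mul (H / 2)).arctan).const_mul (4 * H)
    refine HasDerivAt.congr_deriv h1 ?_
    have := (W_den_pos H y).ne'
    have h3 : (1 + (H / 2 * y) ^ 2) ≠ 0 := by positivity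
    unfold W
    simp only [id]
    field_simp
    ring
  rw [intervalIntegral.integral_eq_sub_of_hasDerivAt (fun y _ => hd y) ((continuous_W H).intervalIntegrable _ _)]
  simp only [mul_zero, Real.arctan_zero, sub_zero]
  nlinarith [Real.arctan_lt_pi_div_two (H / 2 * R)]

end HL

open MeasureTheory Filter Topology Asymptotics
open scoped ENNReal
namespace HL
open Complex (I)

/-- partial theta sums -/
noncomputable def psiN (φ : ℝ) (N : ℕ) (y : ℝ) : ℂ := ∑ n ∈ Finset.range N, hg (bq φ y) ((n:ℝ) + 1)

/-- decay parameter -/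
noncomputable def kp (φ : ℝ) (m n : ℕ) : ℝ := Real.pi * (((m:ℝ) + 1) ^ 2 + ((n:ℝ) + 1) ^ 2) * Real.cos φ
/-- phase parameter -/
noncomputable def ap (φ : ℝ) (m n : ℕ) : ℝ := Real.pi * (((m:ℝ) + 1) ^ 2 - ((n:ℝ) + 1) ^ 2) * Real.sin φ

lemma bq_eq (φ y : ℝ) : bq φ y = ((Real.pi * Real.exp (2 * y) * Real.cos φ : ℝ) : ℂ) + ((Real.pi * Real.exp (2 * y) * Real.sin φ : ℝ) : ℂ) * I := by
  unfold bq
  rw [Complex.exp_add, mul_comm I (φ:ℂ), Complex.exp_mul_I]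
  push_cast
  ring

lemma hg_mul_conj (φ y : ℝ) (m n : ℕ) :
    hg (bq φ y) ((m:ℝ) + 1) * (starRingEnd ℂ) (hg (bq φ y) ((n:ℝ) + 1)) =
      ((Real.exp (-(kp φ m n * Real.exp (2 * y))) : ℝ) : ℂ) * Qa (ap φ m n) y := by
  unfold hg Qa
  rw [← Complex.exp_conj, ← Complex.exp_add, Complex.ofReal_exp, ← Complex.exp_add, bq_eq]
  congr 1
  simp only [kp, ap, map_neg, map_mul, map_add, map_pow, Complex.conj_ofReal, Complex.conj_I]
  push_cast
  ring

/-- the summand -/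
noncomputable def fmn (H φ : ℝ) (m n : ℕ) (y : ℝ) : ℂ :=
  ((W H y * Real.exp y * Real.exp (-(kp φ m n * Real.exp (2 * y))) : ℝ) : ℂ) * Qa (ap φ m n) y

lemma continuous_fmn (H φ : ℝ) (m n : ℕ) : Continuous (fmn H φ m n) := by
  unfold fmn
  have h1 := continuous_W H
  have h2 := continuous_Qa (ap φ m n)
  fun_prop

lemma psiN_sq (H φ : ℝ) (N : ℕ) (y : ℝ) :
    ((W H y * Real.exp y * ‖psiN φ N y‖ ^ 2 : ℝ) : ℂ) = ∑ m ∈ Finset.range N, ∑ n ∈ Finset.range N, fmn H φ m n y := by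
  have : ((‖psiN φ N y‖ ^ 2 : ℝ) : ℂ) = ∑ m ∈ Finset.range N, ∑ n ∈ Finset.range N,
      ((Real.exp (-(kp φ m n * Real.exp (2 * y))) : ℝ) : ℂ) * Qa (ap φ m n) y := by
    simp_rw [← hg_mul_conj]
    rw [Complex.ofReal_pow, ← Complex.mul_conj']
    unfold psiN
    rw [map_sum, Finset.sum_mul_sum]
  rw [Complex.ofReal_mul, this, Finset.mul_sum]
  refine Finset.sum_congr rfl fun m _ => ?_
  rw [Finset.mul_sum]
  refine Finset.sum_congr rfl fun n _ => ?_
  unfold fmn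
  push_cast
  ring

lemma diag_int {H φ δ : ℝ} (hH : 0 ≤ H) (hδ : 0 < δ) (hc : δ ≤ 2 * Real.cos φ) (N : ℕ) {R : ℝ} (hR : 0 ≤ R) :
    ‖∑ m ∈ Finset.range N, ∫ y in (0:ℝ)..R, fmn H φ m m y‖ ≤ Real.pi * H * (Real.sqrt δ)⁻¹ := by
  have hcos : 0 < Real.cos φ := by linarith
  have e : ∀ m : ℕ, ∀ y, fmn H φ m m y = ((W H y * Real.exp y * Real.exp (-(kp φ m m * Real.exp (2 * y))) : ℝ) : ℂ) := by
    intro m y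
    unfold fmn
    have : ap φ m m = 0 := by unfold ap; ring
    rw [this]; unfold Qa; simp
  have hcont : ∀ m : ℕ, Continuous (fun y => W H y * Real.exp y * Real.exp (-(kp φ m m * Real.exp (2 * y)))) := by
    intro m
    have h1 := continuous_W H
    fun_prop
  simp_rw [e]
  simp_rw [intervalIntegral.integral_ofReal]
  rw [← Complex.ofReal_sum, ← intervalIntegral.integral_finsetSum (fun m _ => (hcont m).intervalIntegrable _ _), Complex.norm_real]
  have hnn : 0 ≤ ∫ y in (0:ℝ)..R, ∑ m ∈ Finset.range N, W H y * Real.exp y * Real.exp (-(kp φ m m * Real.exp (2 * y))) := by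
    apply intervalIntegral.integral_nonneg hR
    intro y _
    apply Finset.sum_nonneg
    intro m _
    have := W_nonneg H y
    positivity
  rw [Real.norm_of_nonneg hnn]
  have key : ∀ y, ∑ m ∈ Finset.range N, W H y * Real.exp y * Real.exp (-(kp φ m m * Real.exp (2 * y))) ≤ W H y * ((Real.sqrt δ)⁻¹ / 2) := by
    intro y
    rw [← Finset.mul_sum, mul_assoc]
    apply mul_le_mul_of_nonneg_left _ (W_nonneg H y)
    have hcpos : 0 < 2 * Real.pi * Real.cos φ * Real.exp (2 * y) := by positivity
    have h1 := diag_sum hcpos N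
    have h2 : Real.sqrt (Real.pi / (2 * Real.pi * Real.cos φ * Real.exp (2 * y))) ≤ Real.exp (-y) * (Real.sqrt δ)⁻¹ := by
      rw [← Real.sqrt_inv, ← Real.sqrt_sq (Real.exp_pos (-y)).le, ← Real.sqrt_mul (by positivity)]
      apply Real.sqrt_le_sqrt
      rw [show Real.pi / (2 * Real.pi * Real.cos φ * Real.exp (2 * y)) = (Real.exp (2*y))⁻¹ * (2 * Real.cos φ)⁻¹ by
        field_simp]
      rw [← Real.exp_neg, ← Real.exp_nat_mul]
      rw [show ((2:ℕ):ℝ) * -y = -(2*y) by push_cast; ring]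
      gcongr
    calc Real.exp y * ∑ m ∈ Finset.range N, Real.exp (-(kp φ m m * Real.exp (2 * y)))
        = Real.exp y * ∑ m ∈ Finset.range N, Real.exp (-(2 * Real.pi * Real.cos φ * Real.exp (2 * y)) * ((m:ℝ) + 1) ^ 2) := by
          congr 1
          refine Finset.sum_congr rfl fun m _ => ?_
          congr 1
          unfold kp; ring
      _ ≤ Real.exp y * ((Real.exp (-y) * (Real.sqrt δ)⁻¹) / 2) := by
          gcongr
          linarith
      _ = (Real.sqrt δ)⁻¹ / 2 := by
          rw [Real.exp_neg]; field_simp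
  calc _ ≤ ∫ y in (0:ℝ)..R, W H y * ((Real.sqrt δ)⁻¹ / 2) := by
        apply intervalIntegral.integral_mono_on hR
        · exact (continuous_finsetSum _ fun m _ => hcont m).intervalIntegrable _ _
        · exact ((continuous_W H).mul continuous_const).intervalIntegrable _ _
        · intro y _; exact key y
    _ ≤ 2 * Real.pi * H * ((Real.sqrt δ)⁻¹ / 2) := by
        rw [intervalIntegral.integral_mul_const]
        have := W_integral H hH R
        gcongr
    _ = _ := by ring

lemma off_int {H φ δ : ℝ} (hδ : 0 < δ) (hc : δ ≤ 2 * Real.cos φ) (hs : 1/2 ≤ Real.sin φ) {m n : ℕ} (hmn : m ≠ n)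
    {R : ℝ} (hR : 0 ≤ R) :
    ‖∫ y in (0:ℝ)..R, fmn H φ m n y‖ ≤ 2 * H ^ 2 * (Real.exp (-(δ * ((m:ℝ) + 1) ^ 2)) / |((m:ℝ) + 1) ^ 2 - ((n:ℝ) + 1) ^ 2|) := by
  have hcos : 0 < Real.cos φ := by linarith
  have hpi := Real.pi_gt_three
  have hk : 0 ≤ kp φ m n := by unfold kp; positivity
  have hne : ((m:ℝ) + 1) ^ 2 - ((n:ℝ) + 1) ^ 2 ≠ 0 := by
    intro h
    have : ((m:ℝ) - n) * (m + n + 2) = 0 := by linear_combination h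
    rcases mul_eq_zero.1 this with h | h
    · apply hmn; exact_mod_cast sub_eq_zero.1 h
    · have : (0:ℝ) < m + n + 2 := by positivity
      linarith
  have hA : ap φ m n ≠ 0 := by
    unfold ap
    exact mul_ne_zero (mul_ne_zero Real.pi_ne_zero hne) (by linarith)
  refine (osc_bound H hk hA hR).trans ?_
  rw [mul_div_assoc]
  have hpos := abs_pos.2 hne
  have hA2 : |((m:ℝ) + 1) ^ 2 - ((n:ℝ) + 1) ^ 2| ≤ |ap φ m n| := by
    unfold ap
    rw [abs_mul, abs_mul, abs_of_pos Real.pi_pos, abs_of_pos (by linarith : 0 < Real.sin φ)]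
    nlinarith [mul_le_mul hpi.le hs (by norm_num) Real.pi_pos.le]
  apply mul_le_mul_of_nonneg_left _ (by positivity)
  apply div_le_div₀ (Real.exp_pos _).le _ hpos hA2
  apply Real.exp_le_exp.2
  apply neg_le_neg
  · unfold kp
    have h1 : δ * ((m:ℝ) + 1)^2 ≤ 3 * (((m:ℝ)+1)^2 + 0) * (δ/2) := by nlinarith [sq_nonneg ((m:ℝ)+1)]
    refine h1.trans ?_
    gcongr
    · positivity
    · linarith

lemma theta_fin {H φ δ : ℝ} (hH : 0 ≤ H) (hδ : 0 < δ) (hc : δ ≤ 2 * Real.cos φ) (hs : 1/2 ≤ Real.sin φ) (N : ℕ)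
    {R : ℝ} (hR : 0 ≤ R) :
    ∫ y in (0:ℝ)..R, W H y * Real.exp y * ‖psiN φ N y‖ ^ 2 ≤
      Real.pi * H * (Real.sqrt δ)⁻¹ + 2 * H ^ 2 * (δ ^ (-(3/8) : ℝ) * (K1 * K2)) := by
  have e : ((∫ y in (0:ℝ)..R, W H y * Real.exp y * ‖psiN φ N y‖ ^ 2 : ℝ) : ℂ) =
      ∑ m ∈ Finset.range N, ∑ n ∈ Finset.range N, ∫ y in (0:ℝ)..R, fmn H φ m n y := by
    rw [← intervalIntegral.integral_ofReal]
    simp_rw [psiN_sq]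
    rw [intervalIntegral.integral_finsetSum]
    · refine Finset.sum_congr rfl fun m _ => ?_
      rw [intervalIntegral.integral_finsetSum]
      intro n _; exact (continuous_fmn H φ m n).intervalIntegrable _ _
    · intro m _
      exact (continuous_finsetSum _ fun n _ => continuous_fmn H φ m n).intervalIntegrable _ _
  have e2 : ∑ m ∈ Finset.range N, ∑ n ∈ Finset.range N, ∫ y in (0:ℝ)..R, fmn H φ m n y =
      (∑ m ∈ Finset.range N, ∫ y in (0:ℝ)..R, fmn H φ m m y) +
      ∑ m ∈ Finset.range N, ∑ n ∈ Finset.range N, (if m = n then 0 else ∫ y in (0:ℝ)..R, fmn H φ m n y) := by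
    rw [← Finset.sum_add_distrib]
    refine Finset.sum_congr rfl fun m hm => ?_
    have : ∫ y in (0:ℝ)..R, fmn H φ m m y = ∑ n ∈ Finset.range N, (if m = n then ∫ y in (0:ℝ)..R, fmn H φ m n y else 0) := by
      rw [Finset.sum_ite_eq]; simp [hm]
    rw [this, ← Finset.sum_add_distrib]
    refine Finset.sum_congr rfl fun n _ => ?_
    split_ifs <;> simp
  calc _ ≤ ‖((∫ y in (0:ℝ)..R, W H y * Real.exp y * ‖psiN φ N y‖ ^ 2 : ℝ) : ℂ)‖ := by
        rw [Complex.norm_real]; exact Real.le_norm_self _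
    _ ≤ _ := by
        rw [e, e2]
        refine (norm_add_le _ _).trans (add_le_add (diag_int hH hδ hc N hR) ?_)
        calc _ ≤ ∑ m ∈ Finset.range N, ∑ n ∈ Finset.range N, 2 * H ^ 2 * (if m = n then 0 else
                Real.exp (-(δ * ((m:ℝ) + 1) ^ 2)) / |((m:ℝ) + 1) ^ 2 - ((n:ℝ) + 1) ^ 2|) := by
              refine (norm_sum_le _ _).trans (Finset.sum_le_sum fun m _ => (norm_sum_le _ _).trans (Finset.sum_le_sum fun n _ => ?_))
              split_ifs with h
              · simp
              · exact off_int hδ hc hs h hR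
          _ ≤ _ := by
              simp_rw [← Finset.mul_sum]
              have := off_sum hδ N
              gcongr

end HL

open MeasureTheory Filter Topology Asymptotics
open scoped ENNReal
namespace HL
open Complex (I)

lemma continuous_psiN (φ : ℝ) (N : ℕ) : Continuous (psiN φ N) := by
  unfold psiN hg bq
  fun_prop

lemma psiN_tendsto {φ : ℝ} (h : |φ| < Real.pi / 2) (y : ℝ) :
    Tendsto (fun N => psiN φ N y) atTop (𝓝 (psi φ y)) :=
  (summable_hg (bq_re_pos h y)).hasSum.tendsto_sum_nat

lemma theta_lim {H φ δ : ℝ} (h : |φ| < Real.pi / 2) (hH : 0 ≤ H) (hδ : 0 < δ) (hc : δ ≤ 2 * Real.cos φ)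
    (hs : 1/2 ≤ Real.sin φ) :
    ∫⁻ y in Set.Ioi (0:ℝ), ENNReal.ofReal (W H y * Real.exp y * ‖psi φ y‖ ^ 2) ≤
      ENNReal.ofReal (Real.pi * H * (Real.sqrt δ)⁻¹ + 2 * H ^ 2 * (δ ^ (-(3/8) : ℝ) * (K1 * K2))) := by
  set B := Real.pi * H * (Real.sqrt δ)⁻¹ + 2 * H ^ 2 * (δ ^ (-(3/8) : ℝ) * (K1 * K2))
  let f : ℕ → ℝ → ℝ≥0∞ := fun N => Set.indicator (Set.Ioc (0:ℝ) N) (fun y => ENNReal.ofReal (W H y * Real.exp y * ‖psiN φ N y‖ ^ 2))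
  have hcont : ∀ N, Continuous (fun y => W H y * Real.exp y * ‖psiN φ N y‖ ^ 2) := by
    intro N
    have h1 := continuous_W H
    have h2 := continuous_psiN φ N
    fun_prop
  have hm : ∀ N, Measurable (f N) := fun N =>
    ((hcont N).measurable.ennreal_ofReal).indicator measurableSet_Ioc
  have hb : ∀ N, ∫⁻ y, f N y ≤ ENNReal.ofReal B := by
    intro N
    rw [lintegral_indicator measurableSet_Ioc]
    have hIntOn : IntegrableOn (fun y => W H y * Real.exp y * ‖psiN φ N y‖ ^ 2) (Set.Ioc (0:ℝ) N) :=
      (hcont N).integrableOn_Ioc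
    rw [← ofReal_integral_eq_lintegral_ofReal hIntOn]
    · apply ENNReal.ofReal_le_ofReal
      rw [← intervalIntegral.integral_of_le (by positivity)]
      exact theta_fin hH hδ hc hs N (by positivity)
    · filter_upwards with y
      have := W_nonneg H y
      positivity
  have hlim : ∀ y ∈ Set.Ioi (0:ℝ), Tendsto (fun N => f N y) atTop (𝓝 (ENNReal.ofReal (W H y * Real.exp y * ‖psi φ y‖ ^ 2))) := by
    intro y hy
    have h1 : Tendsto (fun N => ENNReal.ofReal (W H y * Real.exp y * ‖psiN φ N y‖ ^ 2)) atTop (𝓝 (ENNReal.ofReal (W H y * Real.exp y * ‖psi φ y‖ ^ 2))) :=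
      ENNReal.tendsto_ofReal (((psiN_tendsto h y).norm.pow 2).const_mul _)
    refine h1.congr' ?_
    obtain ⟨M, hM⟩ := exists_nat_ge y
    filter_upwards [eventually_ge_atTop M] with N hN
    have : y ∈ Set.Ioc (0:ℝ) N := ⟨hy, hM.trans (by exact_mod_cast hN)⟩
    simp only [f]
    rw [Set.indicator_of_mem this]
  calc _ = ∫⁻ y in Set.Ioi (0:ℝ), liminf (fun N => f N y) atTop := by
        refine setLIntegral_congr_fun measurableSet_Ioi fun y hy => ?_
        exact (hlim y hy).liminf_eq.symm
    _ ≤ ∫⁻ y, liminf (fun N => f N y) atTop := setLIntegral_le_lintegral _ _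
    _ ≤ liminf (fun N => ∫⁻ y, f N y) atTop := lintegral_liminf_le hm
    _ ≤ ENNReal.ofReal B := by
        refine (liminf_le_liminf (Eventually.of_forall hb)).trans ?_
        simp

lemma W_le (H y : ℝ) : W H y ≤ 2 * H ^ 2 := by
  unfold W
  rw [div_le_iff₀ (W_den_pos H y)]
  nlinarith [sq_nonneg (H * (H * y)), sq_nonneg (H*y)]

lemma W_even (H y : ℝ) : W H (-y) = W H y := by unfold W; simp

lemma Gf_sq_le {φ : ℝ} (h : |φ| < Real.pi / 2) (y : ℝ) :
    ‖Gf φ y‖ ^ 2 ≤ 2 * (Real.exp y * ‖psi φ y‖ ^ 2) + Real.exp (-y) / 2 := by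
  rw [Gf_eq h]
  have e1 : ‖Complex.exp ((y:ℂ)/2)‖ ^ 2 = Real.exp y := by
    rw [show (y:ℂ)/2 = ((y/2 : ℝ):ℂ) by push_cast; rfl, Complex.norm_exp_ofReal, ← Real.exp_nat_mul]
    congr 1; push_cast; ring
  have e2 : ‖Complex.exp (-((y:ℂ) + I * φ / 2)) / 2‖ = Real.exp (-y) / 2 := by
    rw [norm_div, Complex.norm_exp]
    simp
  rw [norm_mul, mul_pow, e1]
  have h3 := norm_sub_le (psi φ y) (Complex.exp (-((y:ℂ) + I * φ / 2)) / 2)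
  rw [e2] at h3
  have h4 : ‖psi φ y - Complex.exp (-((y:ℂ) + I * φ / 2)) / 2‖ ^ 2 ≤ 2 * ‖psi φ y‖ ^ 2 + 2 * (Real.exp (-y) / 2) ^ 2 := by
    nlinarith [norm_nonneg (psi φ y - Complex.exp (-((y:ℂ) + I * φ / 2)) / 2), sq_nonneg (‖psi φ y‖ - Real.exp (-y) / 2), norm_nonneg (psi φ y), Real.exp_pos (-y)]
  have h5 : Real.exp y * Real.exp (-y) = 1 := by rw [← Real.exp_add]; simp
  have := mul_le_mul_of_nonneg_left h4 (Real.exp_pos y).le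
  have h6 : Real.exp y * (2 * ‖psi φ y‖ ^ 2 + 2 * (Real.exp (-y) / 2) ^ 2) = 2 * (Real.exp y * ‖psi φ y‖ ^ 2) + (Real.exp y * Real.exp (-y)) * Real.exp (-y) / 2 := by ring
  rw [h6, h5, one_mul] at this
  exact this

lemma theta_half {H φ δ : ℝ} (h : |φ| < Real.pi / 2) (hH : 0 ≤ H) (hδ : 0 < δ) (hc : δ ≤ 2 * Real.cos φ)
    (hs : 1/2 ≤ Real.sin φ) :
    ∫⁻ y in Set.Ioi (0:ℝ), ENNReal.ofReal (‖Gf φ y‖ ^ 2 * W H y) ≤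
      ENNReal.ofReal (2 * (Real.pi * H * (Real.sqrt δ)⁻¹ + 2 * H ^ 2 * (δ ^ (-(3/8) : ℝ) * (K1 * K2))) + H ^ 2) := by
  have hK := mul_nonneg K1_nonneg K2_nonneg
  have hI : IntegrableOn (fun y : ℝ => Real.exp (-y)) (Set.Ioi 0) := integrableOn_exp_neg_Ioi 0
  have hpt : ∀ y, ENNReal.ofReal (‖Gf φ y‖ ^ 2 * W H y) ≤
      ENNReal.ofReal (W H y * Real.exp y * ‖psi φ y‖ ^ 2) * 2 + ENNReal.ofReal (H ^ 2) * ENNReal.ofReal (Real.exp (-y)) := by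
    intro y
    have hW := W_nonneg H y
    rw [show (2:ℝ≥0∞) = ENNReal.ofReal 2 by simp, ← ENNReal.ofReal_mul (by positivity), ← ENNReal.ofReal_mul (by positivity),
      ← ENNReal.ofReal_add (by positivity) (by positivity)]
    apply ENNReal.ofReal_le_ofReal
    have h1 := mul_le_mul_of_nonneg_right (Gf_sq_le h y) hW
    have h2 := mul_le_mul_of_nonneg_right (W_le H y) (Real.exp_pos (-y)).le
    linarith
  calc _ ≤ ∫⁻ y in Set.Ioi (0:ℝ), (ENNReal.ofReal (W H y * Real.exp y * ‖psi φ y‖ ^ 2) * 2 + ENNReal.ofReal (H ^ 2) * ENNReal.ofReal (Real.exp (-y))) :=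
        lintegral_mono hpt
    _ = (∫⁻ y in Set.Ioi (0:ℝ), ENNReal.ofReal (W H y * Real.exp y * ‖psi φ y‖ ^ 2)) * 2 + ENNReal.ofReal (H ^ 2) * ∫⁻ y in Set.Ioi (0:ℝ), ENNReal.ofReal (Real.exp (-y)) := by
        rw [lintegral_add_right _ (by fun_prop), lintegral_mul_const' _ _ (by simp), lintegral_const_mul' _ _ (by simp)]
    _ ≤ ENNReal.ofReal (Real.pi * H * (Real.sqrt δ)⁻¹ + 2 * H ^ 2 * (δ ^ (-(3/8) : ℝ) * (K1 * K2))) * 2 + ENNReal.ofReal (H ^ 2) * 1 := by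
        have h1 := theta_lim h hH hδ hc hs
        have h2 : ∫⁻ y in Set.Ioi (0:ℝ), ENNReal.ofReal (Real.exp (-y)) = 1 := by
          rw [← ofReal_integral_eq_lintegral_ofReal hI (by filter_upwards with y; positivity), integral_exp_neg_Ioi]
          simp
        rw [h2]
        gcongr
    _ = _ := by
        rw [show (2:ℝ≥0∞) = ENNReal.ofReal 2 by simp, mul_one, ← ENNReal.ofReal_mul (by positivity), ← ENNReal.ofReal_add (by positivity) (by positivity)]
        congr 1; ring

lemma theta_full {H φ δ : ℝ} (h : |φ| < Real.pi / 2) (hH : 0 ≤ H) (hδ : 0 < δ) (hc : δ ≤ 2 * Real.cos φ)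
    (hs : 1/2 ≤ Real.sin φ) (hsmall : H * (4 * (K1 * K2) + 1) ≤ δ ^ (-(1/8) : ℝ)) (hδ1 : δ ≤ 1) :
    ∫⁻ y, ENNReal.ofReal (‖Gf φ y‖ ^ 2 * W H y) ≤ ENNReal.ofReal (16 * H * (Real.sqrt δ)⁻¹) := by
  have hK := mul_nonneg K1_nonneg K2_nonneg
  have e : ∫⁻ y in Set.Iic (0:ℝ), ENNReal.ofReal (‖Gf φ y‖ ^ 2 * W H y) = ∫⁻ y in Set.Ioi (0:ℝ), ENNReal.ofReal (‖Gf φ y‖ ^ 2 * W H y) := by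
    rw [setLIntegral_congr (Iio_ae_eq_Iic (a := (0:ℝ))).symm]
    have h1 : ∫⁻ y in Set.Ioi (0:ℝ), ENNReal.ofReal (‖Gf φ y‖ ^ 2 * W H y) = ∫⁻ y in Set.Ioi (0:ℝ), ENNReal.ofReal (‖Gf φ (-y)‖ ^ 2 * W H (-y)) := by
      simp_rw [Gf_symm h, W_even]
    rw [h1]
    have h2 := (Measure.measurePreserving_neg (volume : Measure ℝ)).setLIntegral_comp_preimage_emb
      (MeasurableEquiv.neg ℝ).measurableEmbedding (fun y => ENNReal.ofReal (‖Gf φ y‖ ^ 2 * W H y)) (Set.Iio 0)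
    rw [← h2]
    simp
  rw [← lintegral_add_compl _ (measurableSet_Ioi : MeasurableSet (Set.Ioi (0:ℝ))), Set.compl_Ioi, e, ← two_mul]
  have h1 := theta_half h hH hδ hc hs
  calc _ ≤ 2 * ENNReal.ofReal (2 * (Real.pi * H * (Real.sqrt δ)⁻¹ + 2 * H ^ 2 * (δ ^ (-(3/8) : ℝ) * (K1 * K2))) + H ^ 2) := by gcongr
    _ = ENNReal.ofReal (2 * (2 * (Real.pi * H * (Real.sqrt δ)⁻¹ + 2 * H ^ 2 * (δ ^ (-(3/8) : ℝ) * (K1 * K2))) + H ^ 2)) := by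
        rw [ENNReal.ofReal_mul (by norm_num)]; simp
    _ ≤ _ := by
        apply ENNReal.ofReal_le_ofReal
        have s1 : (Real.sqrt δ)⁻¹ = δ ^ (-(3/8) : ℝ) * δ ^ (-(1/8) : ℝ) := by
          rw [← Real.rpow_add hδ, Real.sqrt_eq_rpow, ← Real.rpow_neg hδ.le]; norm_num
        have s2 : 1 ≤ δ ^ (-(3/8) : ℝ) := Real.one_le_rpow_of_pos_of_le_one_of_nonpos hδ hδ1 (by norm_num)
        set a := δ ^ (-(3/8) : ℝ)
        have s3 : 2 * H ^ 2 * (a * (K1 * K2)) * 2 + H ^ 2 ≤ H * (Real.sqrt δ)⁻¹ := by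
          have : H * (a * (H * (4 * (K1 * K2) + 1))) ≤ H * (a * δ ^ (-(1/8) : ℝ)) := by gcongr
          rw [s1]
          nlinarith [mul_nonneg hH hH]
        have hp := Real.pi_lt_d2
        have s4 : 0 ≤ H * (Real.sqrt δ)⁻¹ := by positivity
        nlinarith

end HL

open MeasureTheory Filter Topology Asymptotics
open scoped ENNReal
namespace HL
open Complex (I)

/-- the angle attached to the height -/
noncomputable def ph (T : ℝ) : ℝ := Real.pi / 2 - 1 / T

lemma ph_lt {T : ℝ} (hT : 1 ≤ T) : |ph T| < Real.pi / 2 := by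
  have h1 : 0 < 1 / T := by positivity
  have h2 : 1 / T ≤ 1 := by rw [div_le_one (by linarith)]; exact hT
  have := Real.pi_gt_three
  unfold ph
  rw [abs_lt]; constructor <;> linarith

lemma mean_sq {H : ℝ} (hH : 0 ≤ H) : ∀ᶠ T : ℝ in atTop,
    ∫⁻ t, ‖∫ u in t..(t+H), ft (Gf (ph T)) u‖ₑ ^ 2 ≤ ENNReal.ofReal (32 * Real.pi * H * Real.sqrt T) := by
  have ht := tendsto_rpow_atTop (by norm_num : (0:ℝ) < 1/8)
  filter_upwards [eventually_ge_atTop 1, ht.eventually_ge_atTop (H * (4 * (K1 * K2) + 1))] with T hT hT2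
  have hT0 : 0 < T := by linarith
  have h1 : 0 < 1 / T := by positivity
  have h2 : 1 / T ≤ 1 := by rw [div_le_one (by linarith)]; exact hT
  have h := ph_lt hT
  have hpi := Real.pi_gt_three
  have hc : 1 / T ≤ 2 * Real.cos (ph T) := by
    unfold ph
    rw [Real.cos_pi_div_two_sub]
    have := Real.mul_le_sin h1.le (by linarith)
    have h4 : 1 / 4 ≤ 1 / Real.pi := one_div_le_one_div_of_le Real.pi_pos Real.pi_le_four
    have h5 : 2 / Real.pi = 2 * (1 / Real.pi) := by ring
    nlinarith
  have hs : 1/2 ≤ Real.sin (ph T) := by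
    unfold ph
    rw [Real.sin_pi_div_two_sub]
    have := Real.one_sub_sq_div_two_le_cos (x := 1 / T)
    nlinarith
  have hsm : H * (4 * (K1 * K2) + 1) ≤ (1 / T) ^ (-(1/8) : ℝ) := by
    rw [one_div, Real.inv_rpow hT0.le, ← Real.rpow_neg hT0.le, neg_neg]; exact hT2
  have h3 := theta_full h hH h1 hc hs hsm h2
  refine (window_plancherel (integrable_Gf h) H hH).trans ?_
  calc _ ≤ ENNReal.ofReal (2 * Real.pi) * ENNReal.ofReal (16 * H * (Real.sqrt (1 / T))⁻¹) := by
        gcongr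
        refine le_trans (lintegral_mono fun y => ?_) h3
        apply ENNReal.ofReal_le_ofReal
        exact mul_le_mul_of_nonneg_left (wk_sq_le H y hH) (by positivity)
    _ = _ := by
        rw [← ENNReal.ofReal_mul (by positivity)]
        congr 1
        rw [one_div, Real.sqrt_inv, inv_inv]; ring

/-- the real Hardy-type function, as a complex number -/
noncomputable def Fh (T t : ℝ) : ℂ := completedRiemannZeta (1/2 + I * t) * (Real.exp (ph T * t / 2) : ℝ)

lemma ft_Gf_Fh {T : ℝ} (hT : 1 ≤ T) (t : ℝ) : 2 * Complex.exp (I * ph T / 4) * ft (Gf (ph T)) t = Fh T t := by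
  rw [ft_Gf' (ph_lt hT)]
  unfold Fh
  rw [show 2 * Complex.exp (I * ph T / 4) * (1 / 2 * completedRiemannZeta (1 / 2 + I * t) * Complex.exp (-(I * (1 / 2 + I * t) * ph T / 2)))
    = completedRiemannZeta (1 / 2 + I * t) * (Complex.exp (I * ph T / 4) * Complex.exp (-(I * (1 / 2 + I * t) * ph T / 2))) by ring, ← Complex.exp_add, Complex.ofReal_exp]
  congr 2
  push_cast
  have := Complex.I_sq
  linear_combination (-(t * ph T / 2 : ℂ)) * this

lemma Fh_zeta {T t : ℝ} (h : Fh T t = 0) : riemannZeta (1 / 2 + I * t) = 0 := by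
  have hne : (1 / 2 + I * t : ℂ) ≠ 0 := by
    intro h
    have := congrArg Complex.re h
    simp at this
  rw [riemannZeta_def_of_ne_zero hne]
  unfold Fh at h
  rcases mul_eq_zero.1 h with h | h
  · rw [h]; simp
  · exact absurd h (by exact_mod_cast (Real.exp_pos _).ne')

end HL

open MeasureTheory Filter Topology Asymptotics
open scoped ENNReal
namespace HL
open Complex (I)

lemma half_ne (t : ℝ) : (1 / 2 + I * t : ℂ) ≠ 0 := by
  intro h
  have := congrArg Complex.re h
  simp at this

lemma completed_eq (t : ℝ) : completedRiemannZeta (1 / 2 + I * t) = Complex.Gammaℝ (1 / 2 + I * t) * riemannZeta (1 / 2 + I * t) := by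
  rw [riemannZeta_def_of_ne_zero (half_ne t)]
  have : Complex.Gammaℝ (1 / 2 + I * t) ≠ 0 := Complex.Gammaℝ_ne_zero_of_re_pos (by simp)
  rw [mul_div_cancel₀ _ this]

lemma Gammaℝ_conj (t : ℝ) : (starRingEnd ℂ) (Complex.Gammaℝ (1 / 2 + I * t)) = Complex.Gammaℝ ((starRingEnd ℂ) (1 / 2 + I * t)) := by
  rw [Complex.Gammaℝ_def, Complex.Gammaℝ_def, map_mul, ← Complex.Gamma_conj]
  congr 1
  · rw [show -(starRingEnd ℂ) (1 / 2 + I * t) / 2 = (starRingEnd ℂ) (-(1 / 2 + I * t) / 2) by simp [Complex.conj_ofNat],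
      Complex.cpow_conj, Complex.conj_ofReal]
    · rw [Complex.arg_ofReal_of_nonneg Real.pi_pos.le]; exact Real.pi_ne_zero.symm
  · congr 1; simp [Complex.conj_ofNat]

lemma Fh_im (T t : ℝ) : (Fh T t).im = 0 := by
  rw [← Complex.conj_eq_iff_im]
  unfold Fh
  rw [map_mul, Complex.conj_ofReal]
  congr 1
  have e : (starRingEnd ℂ) (1 / 2 + I * t) = 1 / 2 + I * ((-t : ℝ) : ℂ) := by
    simp [Complex.conj_ofNat]
  have e2 : 1 / 2 + I * ((-t : ℝ) : ℂ) = 1 - (1 / 2 + I * t) := by push_cast; ring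
  rw [completed_eq, map_mul, Gammaℝ_conj, ← riemannZeta_conj, e, ← completed_eq, e2, completedRiemannZeta_one_sub, completed_eq]

lemma continuous_Fh {T : ℝ} (hT : 1 ≤ T) : Continuous (Fh T) := by
  have : Fh T = fun t => 2 * Complex.exp (I * ph T / 4) * ft (Gf (ph T)) t := funext fun t => (ft_Gf_Fh hT t).symm
  rw [this]
  exact continuous_const.mul (continuous_ft (integrable_Gf (ph_lt hT)))

/-- a lower-bound constant -/
noncomputable def c0 : ℝ := Real.exp (-(3/2)) / 2
lemma c0_pos : 0 < c0 := by unfold c0; positivity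

lemma Fh_lower {T u : ℝ} (hT : 2 ≤ T) (h1 : T ≤ u) (h2 : u ≤ 3 * T) :
    c0 * T ^ (-(1/4) : ℝ) * ‖riemannZeta (1 / 2 + I * u)‖ ≤ ‖Fh T u‖ := by
  have hT0 : 0 < T := by linarith
  unfold Fh
  rw [norm_mul, completed_eq, norm_mul, Complex.norm_real, Real.norm_of_nonneg (Real.exp_pos _).le]
  rw [mul_right_comm ‖Complex.Gammaℝ _‖]
  apply mul_le_mul_of_nonneg_right _ (norm_nonneg _)
  rw [Complex.Gammaℝ_def, norm_mul]
  rw [Complex.norm_cpow_eq_rpow_re_of_pos Real.pi_pos]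
  have e1 : (-(1 / 2 + I * u : ℂ) / 2).re = -(1/4) := by simp; norm_num
  have e2 : ((1 / 2 + I * u : ℂ) / 2) = ((1/4 : ℝ):ℂ) + I * ((u/2 : ℝ) : ℂ) := by push_cast; ring
  rw [e1, e2]
  have h3 := gamma_lower (u/2) (by linarith)
  have hu : 0 < u := by linarith
  calc c0 * T ^ (-(1/4) : ℝ) ≤ Real.pi ^ (-(1/4) : ℝ) * ((u/2) ^ (-(1/4) : ℝ) * Real.exp (-(Real.pi * (u/2) / 2))) * Real.exp (ph T * u / 2) := by
        rw [show Real.pi ^ (-(1/4) : ℝ) * ((u/2) ^ (-(1/4) : ℝ) * Real.exp (-(Real.pi * (u/2) / 2))) * Real.exp (ph T * u / 2)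
          = (Real.pi ^ (-(1/4) : ℝ) * (u/2) ^ (-(1/4) : ℝ)) * (Real.exp (-(Real.pi * (u/2) / 2)) * Real.exp (ph T * u / 2)) by ring,
          ← Real.exp_add, ← Real.mul_rpow Real.pi_pos.le (by positivity)]
        have a1 : (16 * T) ^ (-(1/4) : ℝ) ≤ (Real.pi * (u / 2)) ^ (-(1/4) : ℝ) := by
          apply Real.rpow_le_rpow_of_nonpos (by positivity) _ (by norm_num)
          have := Real.pi_le_four
          nlinarith [Real.pi_pos]
        have a2 : (16 * T) ^ (-(1/4) : ℝ) = 1/2 * T ^ (-(1/4) : ℝ) := by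
          rw [Real.mul_rpow (by norm_num) hT0.le]
          congr 1
          rw [show (16:ℝ) = 2 ^ (4:ℝ) by norm_num, ← Real.rpow_mul (by norm_num)]
          norm_num
        have a3 : Real.exp (-(3/2)) ≤ Real.exp (-(Real.pi * (u/2) / 2) + ph T * u / 2) := by
          apply Real.exp_le_exp.2
          unfold ph
          have : u / T ≤ 3 := by rw [div_le_iff₀ hT0]; exact h2
          have e : -(Real.pi * (u/2) / 2) + (Real.pi / 2 - 1 / T) * u / 2 = -(u / T) / 2 := by ring
          rw [e]; linarith
        calc c0 * T ^ (-(1/4) : ℝ) = (16 * T) ^ (-(1/4) : ℝ) * Real.exp (-(3/2)) := by rw [a2]; unfold c0; ring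
          _ ≤ _ := by gcongr
    _ ≤ _ := by gcongr

end HL

open MeasureTheory Filter Topology Asymptotics
open scoped ENNReal
namespace HL
open Complex (I)

/-- the smoothing kernel on the critical line -/
noncomputable def kL (L u : ℝ) : ℂ := (Complex.exp ((1 / 2 + I * u) * L) - 1) / (1 / 2 + I * u)

/-- indicator piece -/
noncomputable def Ind (L : ℝ) (y : ℝ) : ℂ := Set.indicator (Set.Ioc 0 L) (fun y : ℝ => Complex.exp ((1/2 : ℂ) * y)) y

/-- the function whose Fourier transform is the smoothed zeta minus one -/
noncomputable def Ef (L : ℝ) (y : ℝ) : ℂ := -((Real.exp (L / 2) : ℝ) * Af (L - y) - Af (0 - y) + Ind L y)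

lemma ft_refl (g : ℝ → ℂ) (a u : ℝ) : ft (fun y => g (a - y)) u = Complex.exp (I * u * a) * ft g (-u) := by
  unfold ft
  rw [← integral_const_mul, ← integral_sub_left_eq_self _ volume a]
  refine integral_congr_ae (Eventually.of_forall fun y => ?_)
  dsimp only
  rw [sub_sub_cancel, mul_left_comm, ← Complex.exp_add]
  congr 2; push_cast; ring

lemma integrable_Ind (L : ℝ) : Integrable (Ind L) := by
  unfold Ind
  rw [integrable_indicator_iff measurableSet_Ioc]
  exact (by fun_prop : Continuous fun y : ℝ => Complex.exp ((1/2 : ℂ) * y)).integrableOn_Ioc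

lemma ft_Ind {L : ℝ} (hL : 0 ≤ L) (u : ℝ) : ft (Ind L) u = kL L u := by
  unfold ft Ind kL
  have e : ∀ y : ℝ, Set.indicator (Set.Ioc 0 L) (fun y : ℝ => Complex.exp ((1/2 : ℂ) * y)) y * Complex.exp (I * u * y) =
      Set.indicator (Set.Ioc 0 L) (fun y : ℝ => Complex.exp ((1/2 + I * u) * y)) y := by
    intro y
    by_cases h : y ∈ Set.Ioc 0 L
    · rw [Set.indicator_of_mem h, Set.indicator_of_mem h, ← Complex.exp_add]; congr 1; ring
    · rw [Set.indicator_of_notMem h, Set.indicator_of_notMem h, zero_mul]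
  simp_rw [e]
  rw [integral_indicator measurableSet_Ioc, ← intervalIntegral.integral_of_le hL, integral_exp_mul_complex (half_ne u)]
  simp

lemma integrable_Af_refl (a : ℝ) : Integrable (fun y => Af (a - y)) := integrable_Af.comp_sub_left a

lemma integrable_Ef (L : ℝ) : Integrable (Ef L) := by
  unfold Ef
  exact ((((integrable_Af_refl L).const_mul _).sub (integrable_Af_refl 0)).add (integrable_Ind L)).neg

lemma ft_Ef {L : ℝ} (hL : 0 ≤ L) (u : ℝ) : ft (Ef L) u = (riemannZeta (1 / 2 + I * u) - 1) * kL L u := by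
  have h1 := integrable_char (integrable_Af_refl L) u
  have h2 := integrable_char (integrable_Af_refl 0) u
  have h3 := integrable_char (integrable_Ind L) u
  have e : ft (Ef L) u = -((Real.exp (L / 2) : ℝ) * ft (fun y => Af (L - y)) u - ft (fun y => Af (0 - y)) u + ft (Ind L) u) := by
    unfold ft
    have h12 : Integrable (fun y => (Real.exp (L / 2) : ℝ) * (Af (L - y) * Complex.exp (I * u * y)) - Af (0 - y) * Complex.exp (I * u * y)) :=
      (h1.const_mul _).sub h2
    rw [← integral_const_mul, ← integral_sub (h1.const_mul _) h2, ← integral_add h12 h3, ← integral_neg]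
    refine integral_congr_ae (Eventually.of_forall fun y => ?_)
    unfold Ef
    dsimp only
    ring
  rw [e, ft_refl, ft_refl, ft_Ind hL, ft_Af]
  unfold kL
  have hs := half_ne u
  have e2 : Complex.exp ((1 / 2 + I * u) * L) = (Real.exp (L / 2) : ℝ) * Complex.exp (I * u * L) := by
    rw [Complex.ofReal_exp, ← Complex.exp_add]; congr 1; push_cast; ring
  rw [e2]
  have e3 : Complex.exp (I * u * (0:ℝ)) = 1 := by simp
  rw [e3]
  rw [eq_comm, mul_div_assoc', div_eq_iff hs]
  rw [neg_mul _ (1 / 2 + I * u : ℂ), add_mul _ _ (1 / 2 + I * u : ℂ), div_mul_cancel₀ _ hs]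
  ring

lemma continuous_zeta_line : Continuous (fun u : ℝ => riemannZeta (1 / 2 + I * u)) := by
  simp_rw [ft_Af]
  have := (continuous_ft integrable_Af).comp continuous_neg
  exact (by fun_prop : Continuous fun u : ℝ => -(1 / 2 + I * (u:ℂ))).mul this

lemma continuous_kL (L : ℝ) : Continuous (kL L) := by
  unfold kL
  exact Continuous.div (by fun_prop) (by fun_prop) (fun u => half_ne u)

lemma kL_approx {L u : ℝ} (hL : 0 ≤ L) (h : ‖(1 / 2 + I * u : ℂ)‖ * L ≤ 1 / 4) : ‖kL L u - L‖ ≤ L / 4 := by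
  have hs := half_ne u
  have hs' := norm_pos_iff.2 hs
  have e : kL L u - L = (Complex.exp ((1 / 2 + I * u) * L) - 1 - (1 / 2 + I * u) * L) / (1 / 2 + I * u) := by
    unfold kL
    rw [sub_div _ ((1 / 2 + I * u : ℂ) * L), mul_div_cancel_left₀ _ hs]
  have hn : ‖(1 / 2 + I * u : ℂ) * L‖ = ‖(1 / 2 + I * u : ℂ)‖ * L := by
    rw [norm_mul, Complex.norm_real, Real.norm_of_nonneg hL]
  rw [e, norm_div, div_le_iff₀ hs']
  refine (Complex.norm_exp_sub_one_sub_id_le (by rw [hn]; linarith)).trans ?_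
  rw [hn]
  nlinarith [mul_nonneg hs'.le hL]

end HL

open MeasureTheory Filter Topology Asymptotics
open scoped ENNReal
namespace HL
open Complex (I)

/-- logarithmic series terms -/
noncomputable def lt3 (n : ℕ) : ℝ := (((n:ℝ) + 2) * Real.log ((n:ℝ) + 2) ^ 2)⁻¹

lemma lt3_nonneg (n : ℕ) : 0 ≤ lt3 n := by unfold lt3; positivity

lemma summable_lt3 : Summable lt3 := by
  let f : ℕ → ℝ := fun n => (((n:ℝ) + 1) * Real.log ((n:ℝ) + 1) ^ 2)⁻¹
  have hf : Summable f := by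
    rw [← summable_condensed_iff_of_nonneg]
    · have h2 : Summable (fun k : ℕ => (Real.log 2 ^ 2)⁻¹ * (((k:ℝ)) ^ 2)⁻¹) :=
        (Real.summable_nat_pow_inv.2 (by norm_num)).mul_left _
      refine (summable_nat_add_iff 1).1 ?_
      refine Summable.of_nonneg_of_le (fun k => by positivity) (fun k => ?_) ((summable_nat_add_iff 1).2 h2)
      simp only [f]
      push_cast
      have hp : (0:ℝ) < 2 ^ (k+1) := by positivity
      have h3 : ((k:ℝ)+1) * Real.log 2 ≤ Real.log (2 ^ (k+1) + 1) := by
        have : Real.log ((2:ℝ) ^ (k+1)) = ((k:ℝ)+1) * Real.log 2 := by rw [Real.log_pow]; push_cast; ring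
        rw [← this]
        exact Real.log_le_log hp (by linarith)
      have hl : 0 < Real.log 2 := Real.log_pos (by norm_num)
      have h4 : 0 < ((k:ℝ)+1) * Real.log 2 := by positivity
      have h6 := h4.trans_le h3
      rw [← mul_inv, ← div_eq_mul_inv, div_le_iff₀ (by positivity), ← mul_pow, inv_mul_eq_div, le_div_iff₀ (by positivity)]
      have h5 : (Real.log 2 * ((k:ℝ)+1)) ^ 2 ≤ Real.log (2 ^ (k+1) + 1) ^ 2 := by
        apply pow_le_pow_left₀ (by positivity); linarith
      nlinarith [sq_nonneg (Real.log (2 ^ (k+1) + 1))]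
    · intro n; simp only [f]; positivity
    · intro m n hm hmn
      simp only [f]
      have hm' : (1:ℝ) ≤ m := by exact_mod_cast hm
      have hmn' : (m:ℝ) ≤ n := by exact_mod_cast hmn
      have h1 : 0 < Real.log ((m:ℝ)+1) := Real.log_pos (by linarith)
      have h2 : Real.log ((m:ℝ)+1) ≤ Real.log ((n:ℝ)+1) := Real.log_le_log (by linarith) (by linarith)
      apply inv_anti₀ (by positivity)
      gcongr
  have := (summable_nat_add_iff 1).2 hf
  refine this.congr fun n => ?_
  simp only [f, lt3]
  push_cast
  rw [show (n:ℝ) + 1 + 1 = n + 2 by ring]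

/-- third constant -/
noncomputable def K3 : ℝ := ∑' n, lt3 n
lemma K3_nonneg : 0 ≤ K3 := tsum_nonneg lt3_nonneg

/-- the arithmetic factor -/
noncomputable def d1 (L y : ℝ) : ℝ := Int.fract (Real.exp (L - y)) - Int.fract (Real.exp (-y)) + (if 0 < y ∧ y ≤ L then 1 else 0)

lemma Ef_eq (L y : ℝ) : Ef L y = ((-(d1 L y * Real.exp (y / 2)) : ℝ) : ℂ) := by
  unfold Ef Af frc Ind d1
  have e1 : Real.exp (L / 2) * Real.exp (-(L - y) / 2) = Real.exp (y / 2) := by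
    rw [← Real.exp_add]; congr 1; ring
  have e2 : ((Real.exp (L / 2) : ℝ) : ℂ) * ((Real.exp (-(L - y) / 2) : ℝ) : ℂ) = ((Real.exp (y/2) : ℝ) : ℂ) := by
    rw [← e1]; push_cast; rfl
  have e3 : Real.exp (-(0 - y) / 2) = Real.exp (y / 2) := by congr 1; ring
  have e4 : Complex.exp ((1/2 : ℂ) * y) = ((Real.exp (y/2) : ℝ) : ℂ) := by rw [Complex.ofReal_exp]; congr 1; push_cast; ring
  rw [e3, zero_sub, mul_left_comm, e2]
  by_cases h : 0 < y ∧ y ≤ L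
  · rw [Set.indicator_of_mem (by exact h), e4, if_pos h]; push_cast; ring
  · rw [Set.indicator_of_notMem (by exact h), if_neg h]; push_cast; ring

lemma Ef_norm_sq (L y : ℝ) : ‖Ef L y‖ ^ 2 = d1 L y ^ 2 * Real.exp y := by
  rw [Ef_eq, Complex.norm_real, Real.norm_eq_abs, sq_abs, neg_sq, mul_pow, ← Real.exp_nat_mul]
  congr 2; push_cast; ring

lemma d1_le_one {L y : ℝ} (hy : y ≤ 0) : d1 L y ^ 2 ≤ 1 := by
  unfold d1
  rw [if_neg (by intro h; linarith [h.1])]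
  have h1 := Int.fract_nonneg (Real.exp (L - y))
  have h2 := Int.fract_lt_one (Real.exp (L - y))
  have h3 := Int.fract_nonneg (Real.exp (-y))
  have h4 := Int.fract_lt_one (Real.exp (-y))
  rw [sq_le_one_iff_abs_le_one, abs_le]
  constructor <;> linarith

lemma d1_alt {L : ℝ} (hL : 0 < L) (hL1 : L ≤ 1 / 12) (y : ℝ) :
    d1 L y ^ 2 ≤ 4 * L ^ 2 * Real.exp (-(2 * y)) ∨
      (y ≤ 0 ∧ ∃ n : ℕ, - Real.log ((n:ℝ) + 2) < y ∧ y ≤ L - Real.log ((n:ℝ) + 2)) := by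
  have hE : Real.exp L - 1 ≤ 2 * L := by
    have := Real.abs_exp_sub_one_le (x := L) (by rw [abs_of_pos hL]; linarith)
    rw [abs_of_pos hL] at this
    exact (le_abs_self _).trans this
  have hE0 : 0 ≤ Real.exp L - 1 := by linarith [Real.add_one_le_exp L]
  have hx := Real.exp_pos (-y)
  have hm : Real.exp (L - y) = Real.exp L * Real.exp (-y) := by rw [← Real.exp_add]; congr 1
  have key : d1 L y = (Real.exp L - 1) * Real.exp (-y) → d1 L y ^ 2 ≤ 4 * L ^ 2 * Real.exp (-(2 * y)) := by
    intro h
    rw [h, mul_pow, ← Real.exp_nat_mul, show ((2:ℕ):ℝ) * -y = -(2*y) by push_cast; ring]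
    gcongr
    nlinarith
  by_cases hy : y ≤ 0
  · by_cases hf : ⌊Real.exp (L - y)⌋ = ⌊Real.exp (-y)⌋
    · left; apply key
      unfold d1
      rw [if_neg (by intro h; linarith [h.1])]
      unfold Int.fract
      rw [hf, hm]; ring
    · right
      refine ⟨hy, ?_⟩
      have h1 : 1 ≤ Real.exp (-y) := Real.one_le_exp (by linarith)
      have h2 : ⌊Real.exp (-y)⌋ ≤ ⌊Real.exp (L - y)⌋ := Int.floor_mono (Real.exp_le_exp.2 (by linarith))
      have h3 : ⌊Real.exp (-y)⌋ + 1 ≤ ⌊Real.exp (L - y)⌋ := by omega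
      have h4 : 1 ≤ ⌊Real.exp (-y)⌋ := Int.le_floor.2 (by exact_mod_cast h1)
      obtain ⟨n, hn⟩ : ∃ n : ℕ, ⌊Real.exp (-y)⌋ = n + 1 := ⟨(⌊Real.exp (-y)⌋ - 1).toNat, by omega⟩
      refine ⟨n, ?_, ?_⟩
      · have h5 := Int.lt_floor_add_one (Real.exp (-y))
        rw [hn] at h5; push_cast at h5
        have : -y < Real.log ((n:ℝ) + 2) := by
          rw [Real.lt_log_iff_exp_lt (by positivity)]; linarith
        linarith
      · have h5 : ((n:ℝ) + 2) ≤ Real.exp (L - y) := by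
          have := Int.le_floor.1 h3
          rw [hn] at this; push_cast at this; linarith
        have : Real.log ((n:ℝ)+2) ≤ L - y := by
          rw [Real.log_le_iff_le_exp (by positivity)]; exact h5
        linarith
  · left
    push Not at hy
    apply key
    have hx1 : Real.exp (-y) < 1 := by rw [Real.exp_lt_one_iff]; linarith
    have f1 : Int.fract (Real.exp (-y)) = Real.exp (-y) := Int.fract_eq_self.2 ⟨hx.le, hx1⟩
    unfold d1
    rw [f1]
    by_cases hyL : y ≤ L
    · rw [if_pos ⟨hy, hyL⟩]
      have f2 : Int.fract (Real.exp (L - y)) = Real.exp (L - y) - 1 := by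
        rw [Int.fract_eq_iff]
        have a1 : 1 ≤ Real.exp (L - y) := Real.one_le_exp (by linarith)
        refine ⟨by linarith, ?_, 1, by push_cast; ring⟩
        rw [hm]
        nlinarith
      rw [f2, hm]; ring
    · rw [if_neg (by tauto)]
      have f2 : Int.fract (Real.exp (L - y)) = Real.exp (L - y) :=
        Int.fract_eq_self.2 ⟨(Real.exp_pos _).le, by rw [Real.exp_lt_one_iff]; linarith⟩
      rw [f2, hm]; ring

end HL

open MeasureTheory Filter Topology Asymptotics
open scoped ENNReal
namespace HL
open Complex (I)

/-- short intervals near the logarithms of integers -/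
def sI (L : ℝ) (n : ℕ) : Set ℝ := Set.Ioc (- Real.log ((n:ℝ) + 2)) (L - Real.log ((n:ℝ) + 2))

lemma log_ge (n : ℕ) : 0.69 ≤ Real.log ((n:ℝ) + 2) := by
  have h := Real.log_two_gt_d9
  have : Real.log 2 ≤ Real.log ((n:ℝ) + 2) := Real.log_le_log (by norm_num) (by have := Nat.cast_nonneg (α := ℝ) n; linarith)
  norm_num at h ⊢
  linarith

lemma Ef_pt {H L : ℝ} (hH : 0 ≤ H) (hL : 0 < L) (hL1 : L ≤ 1 / 12) (y : ℝ) :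
    ENNReal.ofReal (‖Ef L y‖ ^ 2 * ‖wk H y‖ ^ 2) ≤
      Set.indicator (Set.Ici (-1)) (fun y => ENNReal.ofReal (4 * L ^ 2 * H ^ 2 * Real.exp (-y))) y
      + Set.indicator (Set.Ici (Real.log (2 * L))) (fun y => ENNReal.ofReal (16 * L ^ 2 * Real.exp (-y))) y
      + Set.indicator (Set.Iio (Real.log (2 * L))) (fun y => ENNReal.ofReal (4 * Real.exp y)) y
      + ∑' n : ℕ, Set.indicator (sI L n) (fun _ => ENNReal.ofReal (16 * lt3 n)) y := by
  rw [Ef_norm_sq]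
  have hw1 : ‖wk H y‖ ^ 2 ≤ H ^ 2 := pow_le_pow_left₀ (norm_nonneg _) (wk_norm_le H y hH) 2
  have hw2 := wk_sq_le' H y
  have hey : Real.exp (-(2 * y)) * Real.exp y = Real.exp (-y) := by rw [← Real.exp_add]; congr 1; ring
  rcases d1_alt hL hL1 y with h | ⟨hy, n, h1, h2⟩
  · have hd : d1 L y ^ 2 * Real.exp y ≤ 4 * L ^ 2 * Real.exp (-y) := by
      rw [← hey, ← mul_assoc]; gcongr
    by_cases hy : -1 ≤ y
    · refine le_trans ?_ (le_add_right (le_add_right (le_add_right le_rfl)))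
      rw [Set.indicator_of_mem (by exact hy)]
      apply ENNReal.ofReal_le_ofReal
      calc _ ≤ 4 * L ^ 2 * Real.exp (-y) * H ^ 2 := by gcongr
        _ = _ := by ring
    · push Not at hy
      have hw3 : ‖wk H y‖ ^ 2 ≤ 4 := by
        have : 1 ≤ y ^ 2 := by nlinarith
        nlinarith [sq_nonneg ‖wk H y‖]
      by_cases hy2 : Real.log (2 * L) ≤ y
      · refine le_trans ?_ (le_add_right (le_add_right (le_add_left le_rfl)))
        rw [Set.indicator_of_mem (by exact hy2)]
        apply ENNReal.ofReal_le_ofReal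
        calc _ ≤ 4 * L ^ 2 * Real.exp (-y) * 4 := by gcongr
          _ = _ := by ring
      · push Not at hy2
        refine le_trans ?_ (le_add_right (le_add_left le_rfl))
        rw [Set.indicator_of_mem (by exact hy2)]
        apply ENNReal.ofReal_le_ofReal
        calc _ ≤ 1 * Real.exp y * 4 := by
              have := d1_le_one (L := L) (y := y) (by linarith)
              gcongr
          _ = _ := by ring
  · refine le_trans ?_ (le_add_left (ENNReal.le_tsum n))
    rw [Set.indicator_of_mem (by exact ⟨h1, h2⟩)]
    apply ENNReal.ofReal_le_ofReal
    have hl := log_ge n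
    set l := Real.log ((n:ℝ) + 2) with hldef
    have hd := d1_le_one (L := L) hy
    have e1 : Real.exp y ≤ 2 * ((n:ℝ) + 2)⁻¹ := by
      calc Real.exp y ≤ Real.exp (L - l) := Real.exp_le_exp.2 h2
        _ = Real.exp L * ((n:ℝ)+2)⁻¹ := by
            rw [Real.exp_sub, hldef, Real.exp_log (by positivity)]; rfl
        _ ≤ _ := by
            gcongr
            have := Real.abs_exp_sub_one_le (x := L) (by rw [abs_of_pos hL]; linarith)
            rw [abs_of_pos hL] at this
            linarith [le_abs_self (Real.exp L - 1)]
    have e2 : ‖wk H y‖ ^ 2 ≤ 8 * (l ^ 2)⁻¹ := by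
      have a1 : (l - L) ^ 2 ≤ y ^ 2 := by nlinarith
      have a2 : l ^ 2 ≤ 2 * y ^ 2 := by
        have : 7/8 * l ≤ l - L := by linarith
        nlinarith
      rw [← div_eq_mul_inv, le_div_iff₀ (by positivity)]
      nlinarith [sq_nonneg ‖wk H y‖]
    calc _ ≤ 1 * (2 * ((n:ℝ) + 2)⁻¹) * (8 * (l ^ 2)⁻¹) := by gcongr
      _ = _ := by unfold lt3; rw [mul_inv]; ring

lemma lint_exp_neg (c a : ℝ) (hc : 0 ≤ c) :
    ∫⁻ y, Set.indicator (Set.Ici a) (fun y => ENNReal.ofReal (c * Real.exp (-y))) y = ENNReal.ofReal (c * Real.exp (-a)) := by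
  rw [lintegral_indicator measurableSet_Ici, setLIntegral_congr Ioi_ae_eq_Ici.symm,
    ← ofReal_integral_eq_lintegral_ofReal ((integrableOn_exp_neg_Ioi a).const_mul c)
      (by filter_upwards with y; positivity), integral_const_mul, integral_exp_neg_Ioi]

lemma lint_exp (c a : ℝ) (hc : 0 ≤ c) :
    ∫⁻ y, Set.indicator (Set.Iio a) (fun y => ENNReal.ofReal (c * Real.exp y)) y = ENNReal.ofReal (c * Real.exp a) := by
  rw [lintegral_indicator measurableSet_Iio, setLIntegral_congr Iio_ae_eq_Iic,
    ← ofReal_integral_eq_lintegral_ofReal ((integrableOn_exp_Iic a).const_mul c)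
      (by filter_upwards with y; positivity), integral_const_mul, integral_exp_Iic]

/-- fourth constant -/
noncomputable def K4 : ℝ := 17 + 16 * K3
lemma K4_pos : 0 < K4 := by unfold K4; linarith [K3_nonneg]

lemma Ef_int {H L : ℝ} (hH : 0 ≤ H) (hL : 0 < L) (hL1 : L ≤ 1 / 12) (hHL : 12 * H ^ 2 * L ≤ 1) :
    ∫⁻ y, ENNReal.ofReal (‖Ef L y‖ ^ 2 * ‖wk H y‖ ^ 2) ≤ ENNReal.ofReal (K4 * L) := by
  refine (lintegral_mono (Ef_pt hH hL hL1)).trans ?_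
  have m1 : Measurable (Set.indicator (Set.Ici (Real.log (2 * L))) (fun y => ENNReal.ofReal (16 * L ^ 2 * Real.exp (-y)))) :=
    Measurable.indicator (by fun_prop) measurableSet_Ici
  have m2 : Measurable (Set.indicator (Set.Iio (Real.log (2 * L))) (fun y => ENNReal.ofReal (4 * Real.exp y))) :=
    Measurable.indicator (by fun_prop) measurableSet_Iio
  have m3 : ∀ n, Measurable (Set.indicator (sI L n) (fun _ => ENNReal.ofReal (16 * lt3 n))) := fun n =>
    Measurable.indicator measurable_const measurableSet_Ioc
  have m4 : Measurable (fun y => ∑' n : ℕ, Set.indicator (sI L n) (fun _ => ENNReal.ofReal (16 * lt3 n)) y) :=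
    Measurable.tsum m3
  rw [lintegral_add_right _ m4, lintegral_add_right _ m2, lintegral_add_right _ m1,
    lintegral_tsum (fun n => (m3 n).aemeasurable), lint_exp_neg _ _ (by positivity), lint_exp_neg _ _ (by positivity),
    lint_exp _ _ (by positivity)]
  have s : ∑' n, ∫⁻ y, Set.indicator (sI L n) (fun _ => ENNReal.ofReal (16 * lt3 n)) y = ENNReal.ofReal (16 * K3 * L) := by
    have : ∀ n, ∫⁻ y, Set.indicator (sI L n) (fun _ => ENNReal.ofReal (16 * lt3 n)) y = ENNReal.ofReal (16 * L * lt3 n) := by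
      intro n
      unfold sI
      rw [lintegral_indicator measurableSet_Ioc, setLIntegral_const, Real.volume_Ioc, ← ENNReal.ofReal_mul (by have := lt3_nonneg n; positivity)]
      congr 1; ring
    simp_rw [this]
    rw [← ENNReal.ofReal_tsum_of_nonneg (fun n => by have := lt3_nonneg n; positivity) (summable_lt3.mul_left _), tsum_mul_left]
    congr 1; unfold K3; ring
  have hK := K3_nonneg
  rw [s, ← ENNReal.ofReal_add (by positivity) (by positivity), ← ENNReal.ofReal_add (by positivity) (by positivity),
    ← ENNReal.ofReal_add (by positivity) (by positivity)]
  apply ENNReal.ofReal_le_ofReal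
  rw [Real.exp_neg (Real.log _), Real.exp_log (by positivity), neg_neg]
  have e1 := Real.exp_one_lt_d9
  have e2 : 16 * L ^ 2 * (2 * L)⁻¹ = 8 * L := by field_simp; norm_num
  rw [e2]
  have e3 : 4 * L ^ 2 * H ^ 2 * Real.exp 1 ≤ L := by
    calc 4 * L ^ 2 * H ^ 2 * Real.exp 1 ≤ 4 * L ^ 2 * H ^ 2 * 3 := by gcongr; linarith
      _ = (12 * H ^ 2 * L) * L := by ring
      _ ≤ 1 * L := by gcongr
      _ = L := one_mul L
  unfold K4
  linarith

/-- mean square of the windowed smoothed zeta-minus-one -/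
lemma Psi_int {H L : ℝ} (hH : 0 ≤ H) (hL : 0 < L) (hL1 : L ≤ 1 / 12) (hHL : 12 * H ^ 2 * L ≤ 1) :
    ∫⁻ t, ‖∫ u in t..(t+H), ft (Ef L) u‖ₑ ^ 2 ≤ ENNReal.ofReal (2 * Real.pi * (K4 * L)) := by
  refine (window_plancherel (integrable_Ef L) H hH).trans ?_
  rw [ENNReal.ofReal_mul (by positivity : 0 ≤ 2 * Real.pi) (q := K4 * L)]
  exact mul_le_mul_right (Ef_int hH hL hL1 hHL) _

end HL

open MeasureTheory Filter Topology Asymptotics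
open scoped ENNReal
namespace HL
open Complex (I)

lemma no_zero_int {f : ℝ → ℂ} (hf : Continuous f) (him : ∀ u, (f u).im = 0) {a b : ℝ} (hab : a ≤ b)
    (hz : ∀ u ∈ Set.Icc a b, f u ≠ 0) : ∫ u in a..b, ‖f u‖ ≤ ‖∫ u in a..b, f u‖ := by
  have e : ∀ u, f u = (((f u).re : ℝ) : ℂ) := fun u => Complex.ext (by simp) (by simp [him u])
  have hre : Continuous (fun u => (f u).re) := Complex.continuous_re.comp hf
  have hz' : ∀ u ∈ Set.Icc a b, (f u).re ≠ 0 := by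
    intro u hu h
    apply hz u hu
    rw [e u, h]; simp
  have e2 : ∫ u in a..b, f u = ((∫ u in a..b, (f u).re : ℝ) : ℂ) := by
    rw [← intervalIntegral.integral_ofReal]
    refine intervalIntegral.integral_congr fun u _ => e u
  rw [e2, Complex.norm_real, Real.norm_eq_abs]
  have hn : ∀ u, ‖f u‖ = |(f u).re| := by intro u; rw [e u, Complex.norm_real, Real.norm_eq_abs]; simp
  simp_rw [hn]
  have hc : IsPreconnected (Set.Icc a b) := isPreconnected_Icc
  by_cases hpos : ∀ u ∈ Set.Icc a b, 0 < (f u).re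
  · refine le_trans (le_of_eq ?_) (le_abs_self _)
    refine intervalIntegral.integral_congr fun u hu => ?_
    rw [Set.uIcc_of_le hab] at hu
    exact abs_of_pos (hpos u hu)
  · push Not at hpos
    obtain ⟨v, hv, hv0⟩ := hpos
    have hneg : ∀ u ∈ Set.Icc a b, (f u).re < 0 := by
      intro u hu
      by_contra h
      push Not at h
      have := hc.intermediate_value hv hu hre.continuousOn
      obtain ⟨w, hw, hw0⟩ := this ⟨hv0, h⟩
      exact hz' w hw hw0
    refine le_trans (le_of_eq ?_) (neg_le_abs _)
    rw [← intervalIntegral.integral_neg]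
    refine intervalIntegral.integral_congr fun u hu => ?_
    rw [Set.uIcc_of_le hab] at hu
    exact abs_of_neg (hneg u hu)

/-- lower bound for the first absolute moment in a short window -/
lemma zeta_window {H T t : ℝ} (hH : 0 ≤ H) (hT : 2 ≤ T) (hHT : H + 1 ≤ T) (h1 : T ≤ t) (h2 : t ≤ 2 * T) :
    3 * H / 5 - 48 / 5 * T * ‖∫ u in t..(t+H), ft (Ef (1 / (12 * T))) u‖ ≤ ∫ u in t..(t+H), ‖riemannZeta (1 / 2 + I * u)‖ := by
  set L := 1 / (12 * T) with hLdef
  have hT0 : 0 < T := by linarith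
  have hL : 0 < L := by positivity
  have hLT : T * L = 1 / 12 := by rw [hLdef]; field_simp
  have hle : t ≤ t + H := by linarith
  have hk : ∀ u ∈ Set.Icc t (t + H), ‖kL L u - L‖ ≤ L / 4 := by
    intro u hu
    apply kL_approx hL.le
    have : ‖(1 / 2 + I * u : ℂ)‖ ≤ 3 * T := by
      calc ‖(1 / 2 + I * u : ℂ)‖ ≤ ‖(1 / 2 : ℂ)‖ + ‖I * u‖ := norm_add_le _ _
        _ = 1 / 2 + |u| := by simp
        _ ≤ 3 * T := by rw [abs_of_nonneg (by linarith [hu.1])]; linarith [hu.2]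
    calc _ ≤ 3 * T * L := by gcongr
      _ = 1 / 4 := by rw [mul_assoc, hLT]; norm_num
  have hck := continuous_kL L
  have hcz := continuous_zeta_line
  have e1 : ∫ u in t..(t+H), riemannZeta (1 / 2 + I * u) * kL L u = (∫ u in t..(t+H), kL L u) + ∫ u in t..(t+H), ft (Ef L) u := by
    rw [← intervalIntegral.integral_add (hck.intervalIntegrable _ _) ((continuous_ft (integrable_Ef L)).intervalIntegrable _ _)]
    refine intervalIntegral.integral_congr fun u _ => ?_
    rw [ft_Ef hL.le]; ring
  have e2 : ‖(∫ u in t..(t+H), kL L u) - (L * H : ℝ)‖ ≤ L / 4 * H := by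
    have : ((L * H : ℝ) : ℂ) = ∫ u in t..(t+H), (L:ℂ) := by
      rw [intervalIntegral.integral_const]; simp; ring
    rw [this, ← intervalIntegral.integral_sub (hck.intervalIntegrable _ _) (by simp)]
    have := intervalIntegral.norm_integral_le_of_norm_le_const (a := t) (b := t + H) (f := fun u => kL L u - L) (C := L / 4)
      (fun u hu => by rw [Set.uIoc_of_le hle] at hu; exact hk u ⟨hu.1.le, hu.2⟩)
    rwa [add_sub_cancel_left, abs_of_nonneg hH] at this
  have e3 : 3 / 4 * (L * H) ≤ ‖∫ u in t..(t+H), kL L u‖ := by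
    have h3 := norm_sub_norm_le ((L * H : ℝ) : ℂ) (∫ u in t..(t+H), kL L u)
    rw [norm_sub_rev, Complex.norm_real, Real.norm_of_nonneg (by positivity)] at h3
    linarith
  have e4 : ‖∫ u in t..(t+H), riemannZeta (1 / 2 + I * u) * kL L u‖ ≤ (∫ u in t..(t+H), ‖riemannZeta (1 / 2 + I * u)‖) * (5 / 4 * L) := by
    refine (intervalIntegral.norm_integral_le_integral_norm hle).trans ?_
    rw [← intervalIntegral.integral_mul_const]
    apply intervalIntegral.integral_mono_on hle
    · exact (hcz.mul hck).norm.intervalIntegrable _ _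
    · exact (hcz.norm.mul continuous_const).intervalIntegrable _ _
    · intro u hu
      rw [norm_mul]
      gcongr
      have := norm_sub_norm_le (kL L u) L
      rw [Complex.norm_real, Real.norm_of_nonneg hL.le] at this
      linarith [hk u hu]
  set P := ‖∫ u in t..(t+H), ft (Ef L) u‖
  set X := ∫ u in t..(t+H), ‖riemannZeta (1 / 2 + I * u)‖
  have e5 : 3 / 4 * (L * H) - P ≤ X * (5 / 4 * L) := by
    rw [e1] at e4
    have := norm_sub_le_norm_add (∫ u in t..(t+H), kL L u) (∫ u in t..(t+H), ft (Ef L) u)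
    linarith
  have e6 := mul_le_mul_of_nonneg_left e5 (by positivity : 0 ≤ 48 / 5 * T)
  have a1 : 48 / 5 * T * (3 / 4 * (L * H) - P) = 36 / 5 * (T * L) * H - 48 / 5 * T * P := by ring
  have a2 : 48 / 5 * T * (X * (5 / 4 * L)) = 12 * (T * L) * X := by ring
  rw [a1, a2, hLT] at e6
  linarith

lemma no_zero_alt {H T t : ℝ} (hH : 0 < H) (hT : 2 ≤ T) (hHT : H + 1 ≤ T) (h1 : T ≤ t) (h2 : t ≤ 2 * T)
    (hz : ∀ u ∈ Set.Icc t (t + H), riemannZeta (1 / 2 + I * u) ≠ 0) :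
    H / (48 * T) ≤ ‖∫ u in t..(t+H), ft (Ef (1 / (12 * T))) u‖ ∨
    c0 * T ^ (-(1/4) : ℝ) * H / 5 ≤ ‖∫ u in t..(t+H), ft (Gf (ph T)) u‖ := by
  have hT0 : 0 < T := by linarith
  have hT1 : 1 ≤ T := by linarith
  have hle : t ≤ t + H := by linarith
  by_contra hcon
  push Not at hcon
  obtain ⟨g1, g2⟩ := hcon
  have hc := c0_pos
  have hp : 0 < T ^ (-(1/4) : ℝ) := by positivity
  have w := zeta_window hH.le hT hHT h1 h2
  rw [lt_div_iff₀ (by positivity)] at g1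
  have w2 : 2 * H / 5 ≤ ∫ u in t..(t+H), ‖riemannZeta (1 / 2 + I * u)‖ := by linarith
  have n := no_zero_int (continuous_Fh hT1) (Fh_im T) hle (fun u hu h => hz u hu (Fh_zeta h))
  have n2 : ∫ u in t..(t+H), Fh T u = 2 * Complex.exp (I * ph T / 4) * ∫ u in t..(t+H), ft (Gf (ph T)) u := by
    rw [← intervalIntegral.integral_const_mul]
    refine intervalIntegral.integral_congr fun u _ => (ft_Gf_Fh hT1 u).symm
  have n3 : ‖Complex.exp (I * ph T / 4)‖ = 1 := by
    rw [show I * (ph T : ℂ) / 4 = ((ph T / 4 : ℝ) : ℂ) * I by push_cast; ring]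
    exact Complex.norm_exp_ofReal_mul_I _
  rw [n2, norm_mul, norm_mul, n3] at n
  have n4 : c0 * T ^ (-(1/4) : ℝ) * ∫ u in t..(t+H), ‖riemannZeta (1 / 2 + I * u)‖ ≤ ∫ u in t..(t+H), ‖Fh T u‖ := by
    rw [← intervalIntegral.integral_const_mul]
    apply intervalIntegral.integral_mono_on hle
    · exact (continuous_const.mul continuous_zeta_line.norm).intervalIntegrable _ _
    · exact (continuous_Fh hT1).norm.intervalIntegrable _ _
    · intro u hu
      exact Fh_lower hT (h1.trans hu.1) (by linarith [hu.2])
  have n5 := mul_le_mul_of_nonneg_left w2 (mul_pos hc hp).le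
  norm_num at n
  linarith

end HL

open MeasureTheory Filter Topology Asymptotics
open scoped ENNReal
namespace HL
open Complex (I)

lemma continuous_window {f : ℝ → ℂ} (hf : Continuous f) (H : ℝ) : Continuous (fun t => ∫ u in t..(t+H), f u) := by
  have e : (fun t => ∫ u in t..(t+H), f u) = fun t => (∫ u in (0:ℝ)..(t+H), f u) - ∫ u in (0:ℝ)..t, f u := by
    funext t
    rw [intervalIntegral.integral_interval_sub_left (hf.intervalIntegrable _ _) (hf.intervalIntegrable _ _)]
  rw [e]
  have h := intervalIntegral.continuous_primitive (μ := volume) (fun a b => hf.intervalIntegrable a b) 0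
  exact (h.comp (by fun_prop : Continuous fun t => t + H)).sub h

lemma markov {g : ℝ → ℂ} (hg : Continuous g) {a B : ℝ} (ha : 0 < a)
    (h : ∫⁻ t, ‖g t‖ₑ ^ 2 ≤ ENNReal.ofReal B) :
    volume {t | a ≤ ‖g t‖} ≤ ENNReal.ofReal (B / a ^ 2) := by
  have hm : AEMeasurable (fun t => ‖g t‖ₑ ^ 2) := (hg.measurable.enorm.pow_const 2).aemeasurable
  have h1 := meas_ge_le_lintegral_div hm (ε := ENNReal.ofReal (a ^ 2)) (by simp; exact ha.ne') ENNReal.ofReal_ne_top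
  calc volume {t | a ≤ ‖g t‖} ≤ volume {t | ENNReal.ofReal (a ^ 2) ≤ ‖g t‖ₑ ^ 2} := by
        apply measure_mono
        intro t ht
        have ht' : a ≤ ‖g t‖ := ht
        rw [Set.mem_ofPred_eq, ENNReal.ofReal_pow ha.le, ← ofReal_norm]
        gcongr
    _ ≤ _ := h1
    _ ≤ ENNReal.ofReal B / ENNReal.ofReal (a ^ 2) := by gcongr
    _ = _ := by rw [ENNReal.ofReal_div_of_pos (by positivity)]

lemma bad_set : ∃ H : ℝ, 0 < H ∧ ∀ᶠ T : ℝ in atTop, ∃ B : Set ℝ, volume B ≤ ENNReal.ofReal (T / 8) ∧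
    ∀ t, T ≤ t → t ≤ 2 * T → t ∉ B → ∃ u ∈ Set.Icc t (t + H), riemannZeta (1 / 2 + I * u) = 0 := by
  have hc := c0_pos
  have hK := K4_pos
  have hpi := Real.pi_pos
  set H : ℝ := 1 + 6144 * Real.pi * K4 + 12800 * Real.pi / c0 ^ 2 with hHdef
  have p1 : 0 < 6144 * Real.pi * K4 := by positivity
  have p2 : 0 < 12800 * Real.pi / c0 ^ 2 := by positivity
  have hH1 : 1 ≤ H := by linarith
  have hH : 0 < H := by linarith
  refine ⟨H, hH, ?_⟩
  filter_upwards [mean_sq hH.le, eventually_ge_atTop 2, eventually_ge_atTop (H + 1), eventually_ge_atTop (H ^ 2)] with T hms hT hHT hHT2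
  have hT0 : 0 < T := by linarith
  refine ⟨{t | H / (48 * T) ≤ ‖∫ u in t..(t+H), ft (Ef (1 / (12 * T))) u‖} ∪
    {t | c0 * T ^ (-(1/4) : ℝ) * H / 5 ≤ ‖∫ u in t..(t+H), ft (Gf (ph T)) u‖}, ?_, ?_⟩
  · have hL : 0 < 1 / (12 * T) := by positivity
    have hL1 : 1 / (12 * T) ≤ 1 / 12 := one_div_le_one_div_of_le (by norm_num) (by linarith)
    have hHL : 12 * H ^ 2 * (1 / (12 * T)) ≤ 1 := by
      rw [show 12 * H ^ 2 * (1 / (12 * T)) = H ^ 2 / T by field_simp, div_le_one hT0]; exact hHT2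
    have v1 := markov (continuous_window (continuous_ft (integrable_Ef (1 / (12 * T)))) H) (by positivity : 0 < H / (48 * T))
      (Psi_int hH.le hL hL1 hHL)
    have v2 := markov (continuous_window (continuous_ft (integrable_Gf (ph_lt (by linarith : 1 ≤ T)))) H)
      (by positivity : 0 < c0 * T ^ (-(1/4) : ℝ) * H / 5) hms
    refine (measure_union_le _ _).trans ((add_le_add v1 v2).trans ?_)
    rw [← ENNReal.ofReal_add (by positivity) (by positivity)]
    apply ENNReal.ofReal_le_ofReal
    have b1 : 2 * Real.pi * (K4 * (1 / (12 * T))) / (H / (48 * T)) ^ 2 ≤ T / 16 := by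
      have : 2 * Real.pi * (K4 * (1 / (12 * T))) / (H / (48 * T)) ^ 2 = (384 * Real.pi * K4) * T / H ^ 2 := by
        field_simp; norm_num
      rw [this, div_le_iff₀ (by positivity)]
      have : 6144 * Real.pi * K4 ≤ H ^ 2 := by nlinarith
      nlinarith
    have b2 : 32 * Real.pi * H * Real.sqrt T / (c0 * T ^ (-(1/4) : ℝ) * H / 5) ^ 2 ≤ T / 16 := by
      have q : (T ^ (-(1/4) : ℝ)) ^ 2 = (Real.sqrt T)⁻¹ := by
        rw [← Real.rpow_natCast, ← Real.rpow_mul hT0.le, Real.sqrt_eq_rpow, ← Real.rpow_neg hT0.le]; norm_num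
      have hs : 0 < Real.sqrt T := Real.sqrt_pos.2 hT0
      have hs2 : Real.sqrt T * Real.sqrt T = T := Real.mul_self_sqrt hT0.le
      have e : (c0 * T ^ (-(1/4) : ℝ) * H / 5) ^ 2 = c0 ^ 2 * (Real.sqrt T)⁻¹ * H ^ 2 / 25 := by rw [← q]; ring
      rw [e]
      have : 32 * Real.pi * H * Real.sqrt T / (c0 ^ 2 * (Real.sqrt T)⁻¹ * H ^ 2 / 25) = (800 * Real.pi / c0 ^ 2) * (Real.sqrt T * Real.sqrt T) / H := by
        field_simp; norm_num
      rw [this, hs2, div_le_iff₀ hH]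
      have : 800 * Real.pi / c0 ^ 2 * 16 ≤ H := by
        have : 800 * Real.pi / c0 ^ 2 * 16 = 12800 * Real.pi / c0 ^ 2 := by ring
        linarith
      nlinarith
    linarith
  · intro t h1 h2 hB
    by_contra hcon
    push Not at hcon
    exact hB (no_zero_alt hH hT hHT h1 h2 hcon)

lemma count_zeros : ∃ H : ℝ, 0 < H ∧ ∀ᶠ T : ℝ in atTop, ∃ S : Finset ℝ,
    (∀ t ∈ S, T ≤ t ∧ t ≤ 2 * T ∧ riemannZeta (1 / 2 + I * t) = 0) ∧ T / (4 * H) ≤ S.card := by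
  classical
  obtain ⟨H, hH, hev⟩ := bad_set
  refine ⟨H, hH, ?_⟩
  filter_upwards [hev, eventually_ge_atTop (8 * H)] with T ⟨B, hB, hz⟩ hT
  have hT0 : 0 < T := by linarith
  set M := ⌊T / (2 * H)⌋₊ with hM
  have hM1 : (M:ℝ) ≤ T / (2 * H) := Nat.floor_le (by positivity)
  have hM2 : T / (2 * H) < M + 1 := Nat.lt_floor_add_one _
  have hM3 : (M:ℝ) * (2 * H) ≤ T := by rwa [le_div_iff₀ (by positivity)] at hM1
  let a : ℕ → ℝ := fun j => T + 2 * j * H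
  let good : ℕ → Prop := fun j => ∃ u, a j ≤ u ∧ u < a j + 2 * H ∧ riemannZeta (1 / 2 + I * u) = 0
  have hend : ∀ j ∈ Finset.range M, a j + 2 * H ≤ 2 * T := by
    intro j hj
    have : (j:ℝ) + 1 ≤ M := by exact_mod_cast Finset.mem_range.1 hj
    simp only [a]
    nlinarith
  have hbadset : ∀ j ∈ (Finset.range M).filter (fun j => ¬ good j), Set.Ico (a j) (a j + H) ⊆ B := by
    intro j hj t ht
    rw [Finset.mem_filter] at hj
    by_contra htB
    have h1 := hend j hj.1
    have h0 : T ≤ a j := by simp only [a]; have : 0 ≤ 2 * (j:ℝ) * H := by positivity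
                            linarith
    obtain ⟨u, hu, hu0⟩ := hz t (h0.trans ht.1) (by linarith [ht.2]) htB
    exact hj.2 ⟨u, ht.1.trans hu.1, by linarith [hu.2, ht.2], hu0⟩
  have hdis : ∀ i j : ℕ, i < j → a i + 2 * H ≤ a j := by
    intro i j hij
    have : (i:ℝ) + 1 ≤ j := by exact_mod_cast hij
    simp only [a]
    nlinarith
  have hbad : (((Finset.range M).filter (fun j => ¬ good j)).card : ℝ) * H ≤ T / 8 := by
    have hpd : ((Finset.range M).filter (fun j => ¬ good j) : Set ℕ).PairwiseDisjoint (fun j => Set.Ico (a j) (a j + H)) := by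
      intro i _ j _ hij
      rw [Function.onFun, Set.disjoint_left]
      intro t h1 h2
      rcases lt_or_gt_of_ne hij with h | h
      · linarith [hdis i j h, h1.2, h2.1]
      · linarith [hdis j i h, h2.2, h1.1]
    have h1 := measure_biUnion_finset (μ := volume) hpd (fun j _ => measurableSet_Ico)
    have h2 : volume (⋃ j ∈ (Finset.range M).filter (fun j => ¬ good j), Set.Ico (a j) (a j + H)) ≤ ENNReal.ofReal (T / 8) :=
      (measure_mono (Set.iUnion₂_subset hbadset)).trans hB
    rw [h1] at h2
    simp only [Real.volume_Ico, add_sub_cancel_left, Finset.sum_const, nsmul_eq_mul] at h2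
    rw [← ENNReal.ofReal_natCast, ← ENNReal.ofReal_mul (by positivity), ENNReal.ofReal_le_ofReal_iff (by positivity)] at h2
    exact h2
  have hsum := Finset.card_filter_add_card_filter_not (s := Finset.range M) good
  rw [Finset.card_range] at hsum
  have hsum' : (((Finset.range M).filter good).card : ℝ) + (((Finset.range M).filter (fun j => ¬ good j)).card : ℝ) = M := by
    exact_mod_cast hsum
  have hex : ∀ j : ℕ, ∃ u : ℝ, good j → (a j ≤ u ∧ u < a j + 2 * H ∧ riemannZeta (1 / 2 + I * u) = 0) := by
    intro j
    by_cases h : good j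
    · obtain ⟨u, hu⟩ := h; exact ⟨u, fun _ => hu⟩
    · exact ⟨0, fun h' => absurd h' h⟩
  choose z hzz using hex
  refine ⟨((Finset.range M).filter good).image z, ?_, ?_⟩
  · intro t ht
    obtain ⟨j, hj, rfl⟩ := Finset.mem_image.1 ht
    rw [Finset.mem_filter] at hj
    obtain ⟨h1, h2, h3⟩ := hzz j hj.2
    have h0 : T ≤ a j := by simp only [a]; have : 0 ≤ 2 * (j:ℝ) * H := by positivity
                            linarith
    exact ⟨h0.trans h1, by linarith [hend j hj.1], h3⟩
  · rw [Finset.card_image_of_injOn]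
    · have hb' : (((Finset.range M).filter (fun j => ¬ good j)).card : ℝ) ≤ T / 8 / H := by rwa [le_div_iff₀ hH]
      have e1 : T / (2 * H) = 4 * (T / 8 / H) := by field_simp; norm_num
      have e2 : T / (4 * H) = 2 * (T / 8 / H) := by field_simp; norm_num
      have e3 : 1 ≤ T / 8 / H := by rw [le_div_iff₀ hH]; linarith
      linarith
    · intro i hi j hj hij
      have hi' := hzz i (Finset.mem_filter.1 hi).2
      have hj' := hzz j (Finset.mem_filter.1 hj).2
      rw [hij] at hi'
      by_contra hne
      rcases lt_or_gt_of_ne hne with h | h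
      · linarith [hdis i j h, hi'.2.1, hj'.1]
      · linarith [hdis j i h, hj'.2.1, hi'.1]

end HL

theorem zeta_critical_line_zeros_linear_lower_bound : ∃ c > (0:ℝ), ∃ T₀ > (0:ℝ), ∀ T ≥ T₀, ∃ S : Finset ℝ, (∀ t ∈ S, 0 < t ∧ t ≤ T ∧ riemannZeta (1 / 2 + Complex.I * t) = 0) ∧ c * T ≤ (S.card : ℝ) := by
  obtain ⟨H, hH, hev⟩ := HL.count_zeros
  obtain ⟨T₁, hT₁⟩ := Filter.eventually_atTop.1 hev
  refine ⟨1 / (8 * H), by positivity, 2 * max T₁ 1, by positivity, fun T hT => ?_⟩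
  have h1 : T₁ ≤ T / 2 := by linarith [le_max_left T₁ 1]
  have h2 : 1 ≤ T / 2 := by linarith [le_max_right T₁ 1]
  obtain ⟨S, hS, hc⟩ := hT₁ (T / 2) h1
  refine ⟨S, fun t ht => ?_, ?_⟩
  · obtain ⟨a, b, c⟩ := hS t ht
    exact ⟨by linarith, by linarith, c⟩
  · refine le_trans (le_of_eq ?_) hc
    field_simp
    ring
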